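/- arXiv:gr-qc/0308055 — 2 statements merged into one kernel-verified Lean document; each statement's English description precedes it below -/
import Mathlib

section
/- For every positive number r and every real number λ, the quantity α^{r/2} e^{2rν + λU} A² is bounded on (t_p,t_i] × ℝ. -/
open MeasureTheory Set

noncomputable section

set_option linter.unusedVariables false

/-- the velocity space `ℝ³` -/
abbrev V3 : Type := ℝ × ℝ × ℝ

/-- partial derivative with respect to the time variable `t` -/
def pt (F : ℝ → ℝ → ℝ) : ℝ → ℝ → ℝ := fun t θ => deriv (fun s => F s θ) t

/-- partial derivative with respect to the space variable `θ` -/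
def pθ (F : ℝ → ℝ → ℝ) : ℝ → ℝ → ℝ := fun t θ => deriv (fun x => F t x) θ

/-- time derivative within `Ici tp` (one-sided at the left endpoint `tp`) -/
def ptW (tp : ℝ) (F : ℝ → ℝ → ℝ) : ℝ → ℝ → ℝ :=
  fun t θ => derivWithin (fun s => F s θ) (Set.Ici tp) t

/-- time derivative of the matter distribution function -/
def ptf (f : ℝ → ℝ → V3 → ℝ) (t θ : ℝ) (v : V3) : ℝ := deriv (fun s => f s θ v) t

/-- one-sided time derivative of the matter distribution function -/
def ptWf (tp : ℝ) (f : ℝ → ℝ → V3 → ℝ) (t θ : ℝ) (v : V3) : ℝ :=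
  derivWithin (fun s => f s θ v) (Set.Ici tp) t

/-- `θ`-derivative of the matter distribution function -/
def pθf (f : ℝ → ℝ → V3 → ℝ) (t θ : ℝ) (v : V3) : ℝ := deriv (fun x => f t x v) θ

/-- derivative in the first velocity variable `v₁` -/
def pv1 (g : V3 → ℝ) (v : V3) : ℝ := deriv (fun y => g (y, v.2.1, v.2.2)) v.1

/-- derivative in the second velocity variable `v₂` -/
def pv2 (g : V3 → ℝ) (v : V3) : ℝ := deriv (fun y => g (v.1, y, v.2.2)) v.2.1

/-- derivative in the third velocity variable `v₃` -/
def pv3 (g : V3 → ℝ) (v : V3) : ℝ := deriv (fun y => g (v.1, v.2.1, y)) v.2.2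

/-- the velocity component `v₀ = −√(α e^{2ν−2U} + α v₁² + α e^{2ν−4U} v₂² + α t⁻² e^{2ν} (v₃ − A v₂)²)` -/
def v0 (α ν U A : ℝ → ℝ → ℝ) (t θ : ℝ) (v : V3) : ℝ :=
  - Real.sqrt (α t θ * Real.exp (2 * ν t θ - 2 * U t θ)
    + α t θ * v.1 ^ 2
    + α t θ * Real.exp (2 * ν t θ - 4 * U t θ) * v.2.1 ^ 2
    + α t θ * (t ^ 2)⁻¹ * Real.exp (2 * ν t θ) * (v.2.2 - A t θ * v.2.1) ^ 2)

/-- `β = ν + (ln α)/2` -/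
def betaF (ν α : ℝ → ℝ → ℝ) : ℝ → ℝ → ℝ := fun t θ => ν t θ + Real.log (α t θ) / 2

/-- the energy `𝓔̃(t) = ∫₀¹ ν_t/(√α t) dθ` -/
def Etilde (ν α : ℝ → ℝ → ℝ) (t : ℝ) : ℝ :=
  ∫ θ in (0:ℝ)..1, pt ν t θ / (Real.sqrt (α t θ) * t)

/-- Slices in `t` of a function smooth on `(tp, ti] × ℝ` have derivative `pt F` in the interior. -/
lemma hasDerivAt_pt {tp ti : ℝ} {F : ℝ → ℝ → ℝ}
    (hF : ContDiffOn ℝ (⊤ : ℕ∞) (fun p : ℝ × ℝ => F p.1 p.2) (Ioc tp ti ×ˢ (univ : Set ℝ)))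
    {t : ℝ} (ht : t ∈ Ioo tp ti) (θ : ℝ) :
    HasDerivAt (fun s => F s θ) (pt F t θ) t := by
  have hn : Ioc tp ti ×ˢ (univ : Set ℝ) ∈ nhds (t, θ) :=
    prod_mem_nhds (Filter.mem_of_superset (Ioo_mem_nhds ht.1 ht.2) Ioo_subset_Ioc_self)
      Filter.univ_mem
  have hd : DifferentiableAt ℝ (fun p : ℝ × ℝ => F p.1 p.2) (t, θ) :=
    (hF.contDiffAt hn).differentiableAt (by simp)
  have hd' : DifferentiableAt ℝ (fun s => F s θ) t :=
    DifferentiableAt.comp (f := fun s : ℝ => (s, θ)) t hd (by fun_prop)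
  exact hd'.hasDerivAt

lemma continuousOn_time_slice {tp ti : ℝ} {F : ℝ → ℝ → ℝ}
    (hF : ContDiffOn ℝ (⊤ : ℕ∞) (fun p : ℝ × ℝ => F p.1 p.2) (Ioc tp ti ×ˢ (univ : Set ℝ)))
    (θ : ℝ) : ContinuousOn (fun s => F s θ) (Ioc tp ti) :=
  hF.continuousOn.comp (f := fun s : ℝ => (s, θ)) (by fun_prop) fun _ hs => ⟨hs, mem_univ _⟩

lemma continuous_space_slice {tp ti : ℝ} {F : ℝ → ℝ → ℝ}
    (hF : ContDiffOn ℝ (⊤ : ℕ∞) (fun p : ℝ × ℝ => F p.1 p.2) (Ioc tp ti ×ˢ (univ : Set ℝ)))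
    {t : ℝ} (ht : t ∈ Ioc tp ti) : Continuous (fun θ => F t θ) :=
  hF.continuousOn.comp_continuous (f := fun θ : ℝ => (t, θ)) (by fun_prop)
    fun _ => ⟨ht, mem_univ _⟩

/-- The matter contribution to `α_t / α` is dominated by the one to `ν_t`. -/
lemma matter_integral_le {a e u b t R : ℝ} (ha : 0 < a) {g w : V3 → ℝ}
    (hg : Continuous g) (hgnn : ∀ v, 0 ≤ g v) (hgs : ∀ v, R < ‖v‖ → g v = 0)
    (hw : ∀ v, w v = - Real.sqrt (a * Real.exp (2 * e - 2 * u) + a * v.1 ^ 2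
      + a * Real.exp (2 * e - 4 * u) * v.2.1 ^ 2
      + a * (t ^ 2)⁻¹ * Real.exp (2 * e) * (v.2.2 - b * v.2.1) ^ 2)) :
    a * Real.exp (2 * e) * ∫ v : V3, g v * (Real.exp (-2 * u) + Real.exp (-4 * u) * v.2.1 ^ 2
        + (t ^ 2)⁻¹ * (v.2.2 - b * v.2.1) ^ 2) / |w v|
      ≤ ∫ v : V3, g v * |w v| := by
  have hwc : Continuous w := by
    rw [funext hw]
    fun_prop
  have hsupp : HasCompactSupport (fun v => g v * |w v|) := by
    refine HasCompactSupport.of_support_subset_isCompact (isCompact_closedBall (0 : V3) R) ?_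
    intro v hv
    by_contra h
    have : R < ‖v‖ := by simpa using h
    exact hv (by simp [hgs v this])
  have hint : Integrable (fun v : V3 => g v * |w v|) :=
    (hg.mul hwc.abs).integrable_of_hasCompactSupport hsupp
  rw [← integral_const_mul]
  refine integral_mono_of_nonneg (Filter.Eventually.of_forall fun v => ?_) hint
    (Filter.Eventually.of_forall fun v => ?_)
  · have := hgnn v
    simp only [Pi.zero_apply]
    positivity
  · have h1 : Real.exp (2 * e - 2 * u) = Real.exp (2 * e) * Real.exp (-2 * u) := by
      rw [← Real.exp_add]; ring_nf
    have h2 : Real.exp (2 * e - 4 * u) = Real.exp (2 * e) * Real.exp (-4 * u) := by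
      rw [← Real.exp_add]; ring_nf
    have hpos : 0 < |w v| := by
      rw [hw v, abs_neg, abs_of_nonneg (Real.sqrt_nonneg _)]
      exact Real.sqrt_pos.2 (by positivity)
    have hsq : |w v| * |w v| = a * Real.exp (2 * e - 2 * u) + a * v.1 ^ 2
        + a * Real.exp (2 * e - 4 * u) * v.2.1 ^ 2
        + a * (t ^ 2)⁻¹ * Real.exp (2 * e) * (v.2.2 - b * v.2.1) ^ 2 := by
      rw [hw v, abs_neg, abs_of_nonneg (Real.sqrt_nonneg _)]
      exact Real.mul_self_sqrt (by positivity)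
    rw [h1, h2] at hsq
    dsimp only
    rw [← mul_div_assoc, div_le_iff₀ hpos, mul_assoc (g v), hsq, mul_left_comm]
    refine mul_le_mul_of_nonneg_left ?_ (hgnn v)
    have : 0 ≤ a * v.1 ^ 2 := by positivity
    linarith

/-- The logarithmic `t`-derivative of `e^{2U} A² + t² e^{-2U}` is controlled by the first
derivatives of `U` and `A`. -/
lemma abs_logDeriv_orbit_le {t u x b b' : ℝ} (ht : 0 < t) :
    |(Real.exp (2 * u) * (2 * x) * b ^ 2 + Real.exp (2 * u) * (2 * b * b')
        + (2 * t * Real.exp (-2 * u) + t ^ 2 * (Real.exp (-2 * u) * (-2 * x))))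
      / (Real.exp (2 * u) * b ^ 2 + t ^ 2 * Real.exp (-2 * u))|
      ≤ 2 * |x| + 2 / t + 2 * |Real.exp (2 * u) * b' / (2 * t)| := by
  have hpq : Real.exp (2 * u) * Real.exp (-2 * u) = 1 := by
    rw [← Real.exp_add]; simp
  set p := Real.exp (2 * u) with hp
  set q := Real.exp (-2 * u) with hq
  have hp0 : 0 < p := Real.exp_pos _
  have hq0 : 0 < q := Real.exp_pos _
  have hD : 0 < p * b ^ 2 + t ^ 2 * q := by positivity
  rw [abs_div, abs_of_pos hD, div_le_iff₀ hD]
  have hb : 2 * t * |b| ≤ p * b ^ 2 + t ^ 2 * q := by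
    have h := mul_nonneg hq0.le (sq_nonneg (p * |b| - t))
    have h' : q * (p * |b| - t) ^ 2
        = (p * q) * (p * |b| ^ 2) - 2 * (p * q) * (t * |b|) + t ^ 2 * q := by ring
    rw [h', hpq, sq_abs] at h
    linarith
  have e1 : |p * (2 * x) * b ^ 2 + t ^ 2 * (q * (-2 * x))|
      ≤ 2 * |x| * (p * b ^ 2 + t ^ 2 * q) := by
    refine (abs_add_le _ _).trans (le_of_eq ?_)
    simp only [abs_mul, abs_pow, abs_neg, abs_of_pos hp0, abs_of_pos hq0, abs_of_pos ht, sq_abs,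
      abs_two]
    ring
  have e2 : |2 * t * q| ≤ 2 / t * (p * b ^ 2 + t ^ 2 * q) := by
    rw [abs_of_pos (by positivity)]
    have h : 2 / t * (p * b ^ 2 + t ^ 2 * q) = 2 / t * (p * b ^ 2) + 2 * t * q := by
      field_simp
    rw [h]
    have : 0 ≤ 2 / t * (p * b ^ 2) := by positivity
    linarith
  have e3 : |p * (2 * b * b')| ≤ 2 * |p * b' / (2 * t)| * (p * b ^ 2 + t ^ 2 * q) := by
    have h : |p * (2 * b * b')| = 2 * |p * b' / (2 * t)| * (2 * t * |b|) := by
      simp only [abs_mul, abs_div, abs_of_pos hp0, abs_of_pos ht, abs_two]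
      field_simp
    rw [h]
    exact mul_le_mul_of_nonneg_left hb (by positivity)
  have h3 := abs_add_three (p * (2 * x) * b ^ 2 + t ^ 2 * (q * (-2 * x))) (2 * t * q)
    (p * (2 * b * b'))
  have hre : p * (2 * x) * b ^ 2 + p * (2 * b * b') + (2 * t * q + t ^ 2 * (q * (-2 * x)))
      = (p * (2 * x) * b ^ 2 + t ^ 2 * (q * (-2 * x))) + 2 * t * q + p * (2 * b * b') := by ring
  rw [hre]
  linarith

/-- Completing the square. -/
lemma neg_sq_div_le {c m z : ℝ} (hc : 0 < c) : -(m ^ 2 / (4 * c)) ≤ c * z ^ 2 - m * z := by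
  have h : c * z ^ 2 - m * z + m ^ 2 / (4 * c) = c * (z - m / (2 * c)) ^ 2 := by
    field_simp
    ring
  have : 0 ≤ c * (z - m / (2 * c)) ^ 2 := by positivity
  linarith

theorem alpha_nu_A_bound
    (tp ti : ℝ) (htp : 0 < tp) (hti : tp < ti)
    (U A ν α J K : ℝ → ℝ → ℝ) (f : ℝ → ℝ → V3 → ℝ)
    (hUsm : ContDiffOn ℝ (⊤ : ℕ∞) (fun p : ℝ × ℝ => U p.1 p.2) (Ioc tp ti ×ˢ (univ : Set ℝ)))
    (hAsm : ContDiffOn ℝ (⊤ : ℕ∞) (fun p : ℝ × ℝ => A p.1 p.2) (Ioc tp ti ×ˢ (univ : Set ℝ)))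
    (hνsm : ContDiffOn ℝ (⊤ : ℕ∞) (fun p : ℝ × ℝ => ν p.1 p.2) (Ioc tp ti ×ˢ (univ : Set ℝ)))
    (hαsm : ContDiffOn ℝ (⊤ : ℕ∞) (fun p : ℝ × ℝ => α p.1 p.2) (Ioc tp ti ×ˢ (univ : Set ℝ)))
    (hJsm : ContDiffOn ℝ (⊤ : ℕ∞) (fun p : ℝ × ℝ => J p.1 p.2) (Ioc tp ti ×ˢ (univ : Set ℝ)))
    (hKsm : ContDiffOn ℝ (⊤ : ℕ∞) (fun p : ℝ × ℝ => K p.1 p.2) (Ioc tp ti ×ˢ (univ : Set ℝ)))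
    (hfsm : ContDiffOn ℝ (⊤ : ℕ∞) (fun p : ℝ × ℝ × V3 => f p.1 p.2.1 p.2.2) (Ioc tp ti ×ˢ (univ : Set (ℝ × V3))))
    (hUper : ∀ t θ, U t (θ + 1) = U t θ)
    (hAper : ∀ t θ, A t (θ + 1) = A t θ)
    (hνper : ∀ t θ, ν t (θ + 1) = ν t θ)
    (hαper : ∀ t θ, α t (θ + 1) = α t θ)
    (hJper : ∀ t θ, J t (θ + 1) = J t θ)
    (hKper : ∀ t θ, K t (θ + 1) = K t θ)
    (hfper : ∀ t θ v, f t (θ + 1) v = f t θ v)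
    (hαpos : ∀ t ∈ Ioc tp ti, ∀ θ : ℝ, 0 < α t θ)
    (hfnn : ∀ t ∈ Ioc tp ti, ∀ (θ : ℝ) (v : V3), 0 ≤ f t θ v)
    (hfsupp : ∀ t ∈ Ioc tp ti, ∃ R : ℝ, ∀ (θ : ℝ) (v : V3), R < ‖v‖ → f t θ v = 0)
    (hvlasov :
      ∀ t ∈ Ioc tp ti, ∀ (θ : ℝ) (v : V3),
      ptf f t θ v
        = pv1 (v0 α ν U A t θ) v * pθf f t θ v
          - (deriv (fun x => v0 α ν U A t x v) θ
              + Real.sqrt (α t θ) * Real.exp (2 * ν t θ) / t ^ 3 * (K t θ - A t θ * J t θ) * (v.2.2 - A t θ * v.2.1)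
              + Real.sqrt (α t θ) * Real.exp (2 * ν t θ - 4 * U t θ) / t * J t θ * v.2.1)
            * pv1 (f t θ) v)
    (hnut :
      ∀ t ∈ Ioc tp ti, ∀ θ : ℝ,
      (pt ν t θ)
        = t * ((pt U t θ) ^ 2 + α t θ * (pθ U t θ) ^ 2
              + Real.exp (4 * U t θ) / (4 * t ^ 2) * ((pt A t θ) ^ 2 + α t θ * (pθ A t θ) ^ 2))
          + α t θ * Real.exp (2 * ν t θ - 4 * U t θ) / (4 * t) * J t θ ^ 2
          + α t θ * Real.exp (2 * ν t θ) / (4 * t ^ 3) * (K t θ - A t θ * J t θ) ^ 2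
          + Real.sqrt (α t θ) * ∫ v : V3, f t θ v * |v0 α ν U A t θ v|)
    (hnuth :
      ∀ t ∈ Ioc tp ti, ∀ θ : ℝ,
      (pθ ν t θ)
        = 2 * t * ((pt U t θ) * (pθ U t θ) + Real.exp (4 * U t θ) / (4 * t ^ 2) * (pt A t θ) * (pθ A t θ))
          - (pθ α t θ) / (2 * α t θ)
          - Real.sqrt (α t θ) * ∫ v : V3, f t θ v * v.1)
    (halt :
      ∀ t ∈ Ioc tp ti, ∀ θ : ℝ,
      (pt α t θ) / α t θ
        = - (α t θ * Real.exp (2 * ν t θ - 4 * U t θ) * J t θ ^ 2 / t)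
          - α t θ * Real.exp (2 * ν t θ) * (K t θ - A t θ * J t θ) ^ 2 / t ^ 3
          - 2 * (α t θ * Real.sqrt (α t θ)) * Real.exp (2 * ν t θ)
            * ∫ v : V3, f t θ v
                * (Real.exp (-2 * U t θ) + Real.exp (-4 * U t θ) * v.2.1 ^ 2
                    + (t ^ 2)⁻¹ * (v.2.2 - A t θ * v.2.1) ^ 2)
                / |v0 α ν U A t θ v|)
    (hjt :
      ∀ t ∈ Ioc tp ti, ∀ θ : ℝ,
      (pt J t θ) = -2 * α t θ * ∫ v : V3, f t θ v * v.1 * v.2.1 / |v0 α ν U A t θ v|)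
    (hjth :
      ∀ t ∈ Ioc tp ti, ∀ θ : ℝ,
      (pθ J t θ) = 2 * ∫ v : V3, f t θ v * v.2.1)
    (hkt :
      ∀ t ∈ Ioc tp ti, ∀ θ : ℝ,
      (pt K t θ) = -2 * α t θ * ∫ v : V3, f t θ v * v.1 * v.2.2 / |v0 α ν U A t θ v|)
    (hkth :
      ∀ t ∈ Ioc tp ti, ∀ θ : ℝ,
      (pθ K t θ) = 2 * ∫ v : V3, f t θ v * v.2.2)
    (hutt :
      ∀ t ∈ Ioc tp ti, ∀ θ : ℝ,
      (pt (pt U) t θ)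
        = α t θ * (pθ (pθ U) t θ) - (pt U t θ) / t
          + (pt α t θ) * (pt U t θ) / (2 * α t θ) + (pθ α t θ) * (pθ U t θ) / 2
          + Real.exp (4 * U t θ) / (2 * t ^ 2) * ((pt A t θ) ^ 2 - α t θ * (pθ A t θ) ^ 2)
          + α t θ * Real.exp (2 * ν t θ - 4 * U t θ) / (2 * t ^ 2) * J t θ ^ 2
          + (α t θ * Real.sqrt (α t θ)) * Real.exp (2 * ν t θ - 2 * U t θ) / (2 * t)
            * ∫ v : V3, f t θ v * (1 + 2 * Real.exp (-2 * U t θ) * v.2.1 ^ 2) / |v0 α ν U A t θ v|)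
    (hatt :
      ∀ t ∈ Ioc tp ti, ∀ θ : ℝ,
      (pt (pt A) t θ)
        = α t θ * (pθ (pθ A) t θ) + (pt A t θ) / t
          + (pt α t θ) * (pt A t θ) / (2 * α t θ) + (pθ α t θ) * (pθ A t θ) / 2
          - 4 * ((pt A t θ) * (pt U t θ) - α t θ * (pθ A t θ) * (pθ U t θ))
          + α t θ * Real.exp (2 * ν t θ - 4 * U t θ) / t ^ 2 * J t θ * (K t θ - A t θ * J t θ)
          + 2 * (α t θ * Real.sqrt (α t θ)) * Real.exp (2 * ν t θ - 4 * U t θ) / t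
            * ∫ v : V3, f t θ v * v.2.1 * (v.2.2 - A t θ * v.2.1) / |v0 α ν U A t θ v|) :
    ∀ r : ℝ, 0 < r → ∀ lam : ℝ, ∃ C : ℝ, ∀ t ∈ Ioc tp ti, ∀ θ : ℝ,
      α t θ ^ (r / 2) * Real.exp (2 * r * ν t θ + lam * U t θ) * A t θ ^ 2 ≤ C := by
  intro r hr lam
  have htpos : ∀ t ∈ Ioc tp ti, 0 < t := fun t ht => htp.trans ht.1
  have hDpos : ∀ t ∈ Ioc tp ti, ∀ θ : ℝ,
      0 < Real.exp (2 * U t θ) * A t θ ^ 2 + t ^ 2 * Real.exp (-2 * U t θ) := by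
    intro t ht θ
    have := htpos t ht
    positivity
  -- `ν + (ln α)/4` grows at least as fast as the wave-map energy density
  have hγ : ∀ t ∈ Ioo tp ti, ∀ θ : ℝ,
      t * ((pt U t θ) ^ 2 + (Real.exp (2 * U t θ) * pt A t θ / (2 * t)) ^ 2)
        ≤ pt ν t θ + pt α t θ / α t θ / 4 := by
    intro t ht' θ
    have ht : t ∈ Ioc tp ti := Ioo_subset_Ioc_self ht'
    have h0 := htpos t ht
    have ha := hαpos t ht θ
    obtain ⟨R, hR⟩ := hfsupp t ht
    have hfc : Continuous (f t θ) :=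
      hfsm.continuousOn.comp_continuous (f := fun v : V3 => (t, θ, v)) (by fun_prop)
        fun _ => ⟨ht, mem_univ _⟩
    have hm := matter_integral_le (e := ν t θ) (u := U t θ) (b := A t θ) (t := t)
      (w := v0 α ν U A t θ) ha hfc (hfnn t ht θ) (hR θ) (fun v => rfl)
    have hV : 0 ≤ ∫ v : V3, f t θ v * |v0 α ν U A t θ v| :=
      integral_nonneg fun v => mul_nonneg (hfnn t ht θ v) (abs_nonneg _)
    rw [hnut t ht θ, halt t ht θ]
    set I₁ := ∫ v : V3, f t θ v * |v0 α ν U A t θ v|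
    set I₂ := ∫ v : V3, f t θ v
                * (Real.exp (-2 * U t θ) + Real.exp (-4 * U t θ) * v.2.1 ^ 2
                    + (t ^ 2)⁻¹ * (v.2.2 - A t θ * v.2.1) ^ 2)
                / |v0 α ν U A t θ v|
    have hs : 0 ≤ Real.sqrt (α t θ) := Real.sqrt_nonneg _
    have hm' := mul_le_mul_of_nonneg_left hm hs
    have hI := mul_nonneg hs hV
    have hexp : Real.exp (4 * U t θ) = Real.exp (2 * U t θ) ^ 2 := by
      rw [← Real.exp_nat_mul]; ring_nf
    have hU : 0 ≤ t * (α t θ * (pθ U t θ) ^ 2) := by positivity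
    have hA : 0 ≤ t * (Real.exp (4 * U t θ) / (4 * t ^ 2) * (α t θ * (pθ A t θ) ^ 2)) := by
      positivity
    have hAt : (Real.exp (2 * U t θ) * pt A t θ / (2 * t)) ^ 2
        = Real.exp (4 * U t θ) / (4 * t ^ 2) * (pt A t θ) ^ 2 := by
      rw [hexp]; ring
    rw [hAt]
    have hJ : α t θ * Real.exp (2 * ν t θ - 4 * U t θ) / (4 * t) * J t θ ^ 2
        = α t θ * Real.exp (2 * ν t θ - 4 * U t θ) * J t θ ^ 2 / t / 4 := by
      field_simp
    have hK : α t θ * Real.exp (2 * ν t θ) / (4 * t ^ 3) * (K t θ - A t θ * J t θ) ^ 2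
        = α t θ * Real.exp (2 * ν t θ) * (K t θ - A t θ * J t θ) ^ 2 / t ^ 3 / 4 := by
      field_simp
    rw [hJ, hK]
    linarith
  set g : ℝ → ℝ → ℝ := fun t θ => 2 * r * ν t θ + r / 2 * Real.log (α t θ) + (lam - 2) * U t θ
    + Real.log (Real.exp (2 * U t θ) * A t θ ^ 2 + t ^ 2 * Real.exp (-2 * U t θ)) with hg
  set m : ℝ := |lam - 2| + 2 with hm
  set c : ℝ := m ^ 2 / (8 * r * tp) + 4 / (8 * r * tp) + 2 / tp with hc
  have hmono : ∀ θ : ℝ, MonotoneOn (fun t => g t θ + c * t) (Ioc tp ti) := by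
    intro θ
    refine monotoneOn_of_hasDerivWithinAt_nonneg (f' := fun t => 2 * r * pt ν t θ
      + r / 2 * (pt α t θ / α t θ) + (lam - 2) * pt U t θ
      + (Real.exp (2 * U t θ) * (2 * pt U t θ) * A t θ ^ 2
        + Real.exp (2 * U t θ) * (2 * A t θ * pt A t θ)
        + (2 * t * Real.exp (-2 * U t θ) + t ^ 2 * (Real.exp (-2 * U t θ) * (-2 * pt U t θ))))
      / (Real.exp (2 * U t θ) * A t θ ^ 2 + t ^ 2 * Real.exp (-2 * U t θ)) + c)
      (convex_Ioc tp ti) ?_ ?_ ?_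
    · have hUc := continuousOn_time_slice hUsm θ
      have hAc := continuousOn_time_slice hAsm θ
      have hνc := continuousOn_time_slice hνsm θ
      have hαc := continuousOn_time_slice hαsm θ
      have hαl := hαc.log fun t ht => (hαpos t ht θ).ne'
      have hDc : ContinuousOn (fun t => Real.exp (2 * U t θ) * A t θ ^ 2
          + t ^ 2 * Real.exp (-2 * U t θ)) (Ioc tp ti) := by fun_prop
      have hDl := hDc.log fun t ht => (hDpos t ht θ).ne'
      simp only [hg]
      fun_prop
    · intro t ht
      rw [interior_Ioc] at ht
      have ht' : t ∈ Ioc tp ti := Ioo_subset_Ioc_self ht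
      have dU := hasDerivAt_pt hUsm ht θ
      have dA := hasDerivAt_pt hAsm ht θ
      have dν := hasDerivAt_pt hνsm ht θ
      have dα := (hasDerivAt_pt hαsm ht θ).log (hαpos t ht' θ).ne'
      have dD := ((((dU.const_mul 2).exp.mul (dA.pow 2)).add
        (((hasDerivAt_id t).pow 2).mul (dU.const_mul (-2)).exp))).log (hDpos t ht' θ).ne'
      have d := ((((dν.const_mul (2 * r)).add (dα.const_mul (r / 2))).add
        (dU.const_mul (lam - 2))).add dD).add ((hasDerivAt_id t).const_mul c)
      refine (d.congr_deriv ?_).hasDerivWithinAt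
      simp
    · intro t ht
      rw [interior_Ioc] at ht
      have ht' : t ∈ Ioc tp ti := Ioo_subset_Ioc_self ht
      have h0 := htpos t ht'
      have hrt : 0 < 2 * r * t := by positivity
      have hγt := mul_le_mul_of_nonneg_left (hγ t ht θ) (by positivity : 0 ≤ 2 * r)
      have hL := abs_le.1 (abs_logDeriv_orbit_le (u := U t θ) (x := pt U t θ) (b := A t θ)
        (b' := pt A t θ) h0)
      have hx := neg_sq_div_le (m := m) (z := |pt U t θ|) hrt
      have hy := neg_sq_div_le (m := 2)
        (z := |Real.exp (2 * U t θ) * pt A t θ / (2 * t)|) hrt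
      rw [sq_abs] at hx hy
      have hlam : -(|lam - 2| * |pt U t θ|) ≤ (lam - 2) * pt U t θ := by
        rw [← abs_mul]; exact neg_abs_le _
      have hb : 8 * r * tp ≤ 4 * (2 * r * t) := by
        have := mul_le_mul_of_nonneg_left ht.1.le hr.le
        linarith
      have c1 : m ^ 2 / (4 * (2 * r * t)) ≤ m ^ 2 / (8 * r * tp) := by gcongr
      have c2 : 2 ^ 2 / (4 * (2 * r * t)) ≤ 4 / (8 * r * tp) := by
        norm_num only
        gcongr
      have c3 : 2 / t ≤ 2 / tp := by
        have := ht.1.le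
        gcongr
      have hxm : m * |pt U t θ| = |lam - 2| * |pt U t θ| + 2 * |pt U t θ| := by
        rw [hm]; ring
      have hL1 := hL.1
      linarith
  have hti' : ti ∈ Ioc tp ti := ⟨hti, le_rfl⟩
  have hgc : Continuous (fun θ => g ti θ) := by
    have hUc := continuous_space_slice hUsm hti'
    have hAc := continuous_space_slice hAsm hti'
    have hνc := continuous_space_slice hνsm hti'
    have hαl := (continuous_space_slice hαsm hti').log fun θ => (hαpos ti hti' θ).ne'
    have hDc : Continuous (fun θ => Real.exp (2 * U ti θ) * A ti θ ^ 2
        + ti ^ 2 * Real.exp (-2 * U ti θ)) := by fun_prop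
    have hDl := hDc.log fun θ => (hDpos ti hti' θ).ne'
    simp only [hg]
    fun_prop
  have hgper : Function.Periodic (fun θ => g ti θ) 1 := by
    intro θ
    simp only [hg, hUper, hAper, hνper, hαper]
  obtain ⟨M, hM⟩ := (Function.Periodic.compact_of_continuous hgper one_ne_zero hgc).bddAbove
  refine ⟨Real.exp (M + c * ti), fun t ht θ => ?_⟩
  have hc0 : 0 ≤ c := by positivity
  have h0 := htpos t ht
  have hgle : g t θ ≤ M + c * ti := by
    have h1 := hmono θ ht hti' ht.2
    have h2 : g ti θ ≤ M := hM ⟨θ, rfl⟩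
    have h3 : 0 ≤ c * t := by positivity
    dsimp only at h1
    linarith
  refine le_trans ?_ (Real.exp_le_exp.2 hgle)
  simp only [hg]
  have hexp : Real.exp (Real.log (α t θ) * (r / 2)) * Real.exp (2 * r * ν t θ + lam * U t θ)
      = Real.exp (2 * r * ν t θ + r / 2 * Real.log (α t θ) + (lam - 2) * U t θ)
        * Real.exp (2 * U t θ) := by
    rw [← Real.exp_add, ← Real.exp_add]
    ring_nf
  rw [Real.exp_add _ (Real.log _), Real.exp_log (hDpos t ht θ),
    Real.rpow_def_of_pos (hαpos t ht θ), hexp, mul_add, ← mul_assoc]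
  exact le_add_of_nonneg_right (by positivity)
end
end

section
/- There exists a number C₄ > 0 such that for every t ∈ (t_p,t_i]: ∫₀¹ |β_θ(t,θ)| dθ < C₄, ∫₀¹ |U_θ(t,θ)| dθ < C₄, ∫₀¹ e^{2U(t,θ)} |A_θ(t,θ)| dθ < C₄, ∫₀¹ |J_θ(t,θ)| dθ < C₄, and ∫₀¹ |K_θ(t,θ)| dθ < C₄. Consequently, for each fixed t ∈ (t_p,t_i], the difference between the maximum and minimum values over θ ∈ [0,1] of each of the functions β(t,·), U(t,·), J(t,·), K(t,·) is less than C₄. -/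
open MeasureTheory Set

noncomputable section

set_option linter.unusedVariables false

section ParametricCalculus

variable {X : Type*} [NormedAddCommGroup X] [NormedSpace ℝ X]

lemma ContDiffOn.slice_right {n : WithTop ℕ∞} {s : Set ℝ} {g : ℝ × X → ℝ}
    (hg : ContDiffOn ℝ n g (s ×ˢ univ)) {t : ℝ} (ht : t ∈ s) :
    ContDiff ℝ n (fun x => g (t, x)) := by
  rw [← contDiffOn_univ]
  exact hg.comp (contDiff_prodMk_right t).contDiffOn fun x _ => ⟨ht, mem_univ x⟩

lemma hasDerivAt_fst_of_contDiffOn {a b : ℝ} {g : ℝ × X → ℝ}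
    (hg : ContDiffOn ℝ (⊤ : ℕ∞) g (Ioo a b ×ˢ univ)) {t : ℝ} (ht : t ∈ Ioo a b) (x : X) :
    HasDerivAt (fun s => g (s, x)) (fderiv ℝ g (t, x) (1, 0)) t := by
  have h1 : HasFDerivAt g (fderiv ℝ g (t, x)) (t, x) :=
    ((hg.contDiffAt ((isOpen_Ioo.prod isOpen_univ).mem_nhds ⟨ht, mem_univ x⟩)).differentiableAt
      (by simp)).hasFDerivAt
  exact h1.comp_hasDerivAt t ((hasDerivAt_id t).prodMk (hasDerivAt_const t x))

lemma contDiffOn_deriv_fst {a b : ℝ} {g : ℝ × X → ℝ}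
    (hg : ContDiffOn ℝ (⊤ : ℕ∞) g (Ioo a b ×ˢ univ)) :
    ContDiffOn ℝ (⊤ : ℕ∞) (fun p : ℝ × X => deriv (fun s => g (s, p.2)) p.1)
      (Ioo a b ×ˢ univ) := by
  have h1 := hg.fderiv_of_isOpen (m := (⊤ : ℕ∞)) (isOpen_Ioo.prod isOpen_univ) (by simp)
  refine (h1.clm_apply (contDiffOn_const (c := ((1 : ℝ), (0 : X))))).congr ?_
  rintro ⟨t, x⟩ ⟨ht, -⟩
  exact (hasDerivAt_fst_of_contDiffOn hg ht x).deriv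

lemma contDiffOn_deriv_snd {s : Set ℝ} (hs : UniqueDiffOn ℝ s) {g : ℝ × ℝ → ℝ}
    (hg : ContDiffOn ℝ (⊤ : ℕ∞) g (s ×ˢ univ)) :
    ContDiffOn ℝ (⊤ : ℕ∞) (fun p : ℝ × ℝ => deriv (fun x => g (p.1, x)) p.2) (s ×ˢ univ) := by
  have h1 := hg.fderivWithin (m := (⊤ : ℕ∞)) (hs.prod uniqueDiffOn_univ) (by simp)
  refine (h1.clm_apply (contDiffOn_const (c := ((0 : ℝ), (1 : ℝ))))).congr ?_
  rintro ⟨t, x⟩ ⟨ht, -⟩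
  have h2 : HasFDerivWithinAt g (fderivWithin ℝ g (s ×ˢ univ) (t, x)) (s ×ˢ univ) (t, x) :=
    ((hg (t, x) ⟨ht, mem_univ x⟩).differentiableWithinAt (by simp)).hasFDerivWithinAt
  have h3 := h2.comp_hasDerivWithinAt (s := univ) x
    ((hasDerivAt_const x t).prodMk (hasDerivAt_id x)).hasDerivWithinAt
    (fun y _ => ⟨ht, mem_univ _⟩)
  exact (hasDerivWithinAt_univ.1 h3).deriv

variable [MeasurableSpace X] [OpensMeasurableSpace X]

lemma hasDerivAt_setIntegral_of_contDiffOn {μ : Measure X} [IsFiniteMeasureOnCompacts μ]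
    {a b : ℝ} {g : ℝ × X → ℝ} (hg : ContDiffOn ℝ (⊤ : ℕ∞) g (Ioo a b ×ˢ univ))
    {k : Set X} (hk : IsCompact k) {t : ℝ} (ht : t ∈ Ioo a b) :
    HasDerivAt (fun s => ∫ x in k, g (s, x) ∂μ)
      (∫ x in k, deriv (fun s => g (s, x)) t ∂μ) t := by
  obtain ⟨c, d, htcd, hsub⟩ : ∃ c d, t ∈ Ioo c d ∧ Icc c d ⊆ Ioo a b := by
    refine ⟨(a + t) / 2, (t + b) / 2, ⟨by linarith [ht.1], by linarith [ht.2]⟩, fun s hs => ?_⟩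
    exact ⟨by linarith [ht.1, hs.1], by linarith [ht.2, hs.2]⟩
  have hd := (contDiffOn_deriv_fst hg).continuousOn
  obtain ⟨C, hC⟩ := ((isCompact_Icc (a := c) (b := d)).prod hk).exists_bound_of_continuousOn
    (hd.mono (prod_mono hsub (subset_univ k)))
  have hslice : ∀ s ∈ Ioo a b, Continuous fun x => g (s, x) := fun s hs =>
    (hg.slice_right hs).continuous
  refine (hasDerivAt_integral_of_dominated_loc_of_deriv_le (bound := fun _ => C)
    (F := fun s x => g (s, x)) (F' := fun s x => deriv (fun s => g (s, x)) s)
    (Ioo_mem_nhds htcd.1 htcd.2) ?_ ?_ ?_ ?_ ?_ ?_).2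
  · filter_upwards [Ioo_mem_nhds ht.1 ht.2] with s hs
    exact (hslice s hs).aestronglyMeasurable
  · exact (hslice t ht).continuousOn.integrableOn_compact hk
  · exact ((contDiffOn_deriv_fst hg).slice_right ht).continuous.aestronglyMeasurable
  · refine ae_restrict_of_forall_mem hk.measurableSet fun x hx s hs => ?_
    exact hC (s, x) ⟨Ioo_subset_Icc_self hs, hx⟩
  · exact integrableOn_const hk.measure_ne_top
  · refine Filter.Eventually.of_forall fun x s hs => ?_
    exact (hasDerivAt_fst_of_contDiffOn hg (hsub (Ioo_subset_Icc_self hs)) x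
      ).differentiableAt.hasDerivAt

end ParametricCalculus

lemma continuousOn_setIntegral {X : Type*} [NormedAddCommGroup X] [MeasurableSpace X]
    [OpensMeasurableSpace X] {μ : Measure X} [IsFiniteMeasureOnCompacts μ] [IsLocallyFiniteMeasure μ]
    {s : Set ℝ} (hs : IsCompact s) {g : ℝ × X → ℝ} (hg : ContinuousOn g (s ×ˢ univ))
    {k : Set X} (hk : IsCompact k) :
    ContinuousOn (fun t => ∫ x in k, g (t, x) ∂μ) s := by
  rw [continuousOn_iff_continuous_domRestrict]
  have := isCompact_iff_compactSpace.1 hs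
  refine continuous_parametric_integral_of_continuous (X := s)
    (f := fun t x => g (t.1, x)) ?_ hk
  exact hg.comp_continuous (f := fun p : s × X => (p.1.1, p.2)) (by fun_prop)
    fun p => ⟨p.1.2, mem_univ _⟩

lemma fderiv_apply_one_zero {h : ℝ × ℝ → ℝ} {x : ℝ × ℝ} (hh : DifferentiableAt ℝ h x) :
    fderiv ℝ h x (1, 0) = deriv (fun θ => h (θ, x.2)) x.1 :=
  (HasFDerivAt.comp_hasDerivAt (f := fun θ => (θ, x.2)) x.1 hh.hasFDerivAt
    ((hasDerivAt_id x.1).prodMk (hasDerivAt_const x.1 x.2))).deriv.symm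

lemma fderiv_apply_zero_one {h : ℝ × ℝ → ℝ} {x : ℝ × ℝ} (hh : DifferentiableAt ℝ h x) :
    fderiv ℝ h x (0, 1) = deriv (fun y => h (x.1, y)) x.2 :=
  (HasFDerivAt.comp_hasDerivAt (f := fun y => (x.1, y)) x.2 hh.hasFDerivAt
    ((hasDerivAt_const x.2 x.1).prodMk (hasDerivAt_id x.2))).deriv.symm

/-- A Hamiltonian flow on the cylinder, perturbed by a force depending on the position only, is
divergence free. -/
lemma setIntegral_hamiltonian_eq_zero {V h : ℝ × ℝ → ℝ} {G : ℝ → ℝ} {R : ℝ} (hR : 0 ≤ R)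
    (hV : ContDiff ℝ (⊤ : ℕ∞) V) (hh : ContDiff ℝ (⊤ : ℕ∞) h) (hG : ContDiff ℝ (⊤ : ℕ∞) G)
    (hVper : ∀ x, V (x + (1, 0)) = V x) (hhper : ∀ x, h (x + (1, 0)) = h x)
    (hR₁ : ∀ θ, h (θ, R) = 0) (hR₂ : ∀ θ, h (θ, -R) = 0) :
    ∫ x in Icc (0 : ℝ) 1 ×ˢ Icc (-R) R,
      (fderiv ℝ V x (0, 1) * fderiv ℝ h x (1, 0)
        - (fderiv ℝ V x (1, 0) + G x.1) * fderiv ℝ h x (0, 1)) = 0 := by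
  have hV' : ContDiff ℝ (⊤ : ℕ∞) (fderiv ℝ V) := hV.fderiv_right (by simp)
  have hh' : ContDiff ℝ (⊤ : ℕ∞) (fderiv ℝ h) := hh.fderiv_right (by simp)
  let P : ℝ × ℝ → ℝ := fun x => fderiv ℝ V x (0, 1) * h x
  let W : ℝ × ℝ → ℝ := fun x => -((fderiv ℝ V x (1, 0) + G x.1) * h x)
  have hP : ContDiff ℝ (⊤ : ℕ∞) P := (hV'.clm_apply contDiff_const).mul hh
  have hW : ContDiff ℝ (⊤ : ℕ∞) W :=
    (((hV'.clm_apply contDiff_const).add (hG.comp contDiff_fst)).mul hh).neg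
  have hint : Continuous fun x => fderiv ℝ V x (0, 1) * fderiv ℝ h x (1, 0)
        - (fderiv ℝ V x (1, 0) + G x.1) * fderiv ℝ h x (0, 1) := by
    have := hV'.continuous
    have := hh'.continuous
    have := hG.continuous
    fun_prop
  have hdiv : ∀ x, fderiv ℝ P x (1, 0) + fderiv ℝ W x (0, 1)
      = fderiv ℝ V x (0, 1) * fderiv ℝ h x (1, 0)
        - (fderiv ℝ V x (1, 0) + G x.1) * fderiv ℝ h x (0, 1) := by
    intro x
    have d2 : HasFDerivAt (fderiv ℝ V) (fderiv ℝ (fderiv ℝ V) x) x :=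
      (hV'.differentiable (by simp) x).hasFDerivAt
    have dV : ∀ v, HasFDerivAt (fun x => fderiv ℝ V x v) ((fderiv ℝ (fderiv ℝ V) x).flip v) x := by
      intro v
      simpa using d2.clm_apply (hasFDerivAt_const v x)
    have dh : HasFDerivAt h (fderiv ℝ h x) x := (hh.differentiable (by simp) x).hasFDerivAt
    have dG : HasFDerivAt (fun x : ℝ × ℝ => G x.1)
        ((deriv G x.1) • ContinuousLinearMap.fst ℝ ℝ ℝ) x :=
      (hG.differentiable (by simp) x.1).hasDerivAt.comp_hasFDerivAt x hasFDerivAt_fst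
    have eP : fderiv ℝ P x = _ := ((dV (0, 1)).mul dh).fderiv
    have eW : fderiv ℝ W x = _ := (((dV (1, 0)).add dG).mul dh).neg.fderiv
    have hsymm : fderiv ℝ (fderiv ℝ V) x (1, 0) (0, 1) = fderiv ℝ (fderiv ℝ V) x (0, 1) (1, 0) :=
      (hV.contDiffAt.isSymmSndFDerivAt (by
        rw [minSmoothness_of_isRCLikeNormedField]; exact WithTop.coe_le_coe.2 le_top)) (1, 0) (0, 1)
    rw [eP, eW]
    simp [hsymm]
    ring
  have key := integral2_divergence_prod_of_hasFDerivAt P W (fderiv ℝ P) (fderiv ℝ W) 0 (-R) 1 R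
    hP.continuous.continuousOn hW.continuous.continuousOn
    (fun x _ => (hP.differentiable (by simp) x).hasFDerivAt)
    (fun x _ => (hW.differentiable (by simp) x).hasFDerivAt)
    (by
      simp_rw [hdiv]
      exact hint.continuousOn.integrableOn_compact (isCompact_uIcc.prod isCompact_uIcc))
  simp_rw [hdiv] at key
  have hPper : ∀ y, P (1, y) = P (0, y) := by
    intro y
    have e1 : fderiv ℝ V (1, y) = fderiv ℝ V (0, y) := by
      have := fderiv_comp_add_right (𝕜 := ℝ) (f := V) (x := (0, y)) (1, 0)
      simp_rw [hVper] at this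
      simpa using this.symm
    have e2 : h (1, y) = h (0, y) := by simpa using hhper (0, y)
    simp only [P, e1, e2]
  rw [Measure.volume_eq_prod, setIntegral_prod _ (by
      rw [← Measure.volume_eq_prod]
      exact hint.continuousOn.integrableOn_compact (isCompact_Icc.prod isCompact_Icc)),
    integral_Icc_eq_integral_Ioc, ← intervalIntegral.integral_of_le zero_le_one]
  simp_rw [integral_Icc_eq_integral_Ioc,
    ← intervalIntegral.integral_of_le (show -R ≤ R by linarith)]
  rw [key]
  simp only [hPper, W, hR₁, hR₂]
  simp

/-- Mass of a nonnegative density transported by a Hamiltonian flow with at most linearly growing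
force cannot be created towards the past. -/
theorem setIntegral_le_of_hamiltonian_transport {t₀ t₁ Λ : ℝ} (hlt : t₀ < t₁) (hΛ : 0 ≤ Λ)
    {V : ℝ → ℝ × ℝ → ℝ} {G : ℝ → ℝ → ℝ} {f : ℝ × ℝ × ℝ → ℝ}
    (hV : ∀ t ∈ Ioo t₀ t₁, ContDiff ℝ (⊤ : ℕ∞) (V t))
    (hVper : ∀ t ∈ Ioo t₀ t₁, ∀ x, V t (x + (1, 0)) = V t x)
    (hG : ∀ t ∈ Ioo t₀ t₁, ContDiff ℝ (⊤ : ℕ∞) (G t))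
    (hf : ContDiffOn ℝ (⊤ : ℕ∞) f (Ioo t₀ t₁ ×ˢ univ))
    (hfc : ContinuousOn f (Icc t₀ t₁ ×ˢ univ))
    (hfper : ∀ t x, f (t, x + (1, 0)) = f (t, x))
    (hfnn : ∀ t ∈ Icc t₀ t₁, ∀ x, 0 ≤ f (t, x))
    (hsupp₀ : ∃ R, ∀ θ y, R < |y| → f (t₀, θ, y) = 0)
    (hsupp₁ : ∃ R, ∀ θ y, R < |y| → f (t₁, θ, y) = 0)
    (hgrow : ∀ t ∈ Ioo t₀ t₁, ∀ θ ∈ Icc (0 : ℝ) 1, ∀ y,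
      |y * (fderiv ℝ (V t) (θ, y) (1, 0) + G t θ)| ≤ Λ * (1 + y ^ 2))
    (heq : ∀ t ∈ Ioo t₀ t₁, ∀ x, deriv (fun s => f (s, x)) t
      = fderiv ℝ (V t) x (0, 1) * fderiv ℝ (fun x => f (t, x)) x (1, 0)
        - (fderiv ℝ (V t) x (1, 0) + G t x.1) * fderiv ℝ (fun x => f (t, x)) x (0, 1)) :
    ∫ x in Icc (0 : ℝ) 1 ×ˢ univ, f (t₀, x) ≤ ∫ x in Icc (0 : ℝ) 1 ×ˢ univ, f (t₁, x) := by
  obtain ⟨R₀, hR₀⟩ := hsupp₀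
  obtain ⟨R₁, hR₁⟩ := hsupp₁
  set L : ℝ := 1 + R₀ ^ 2 with hL
  have hLpos : 0 < L := by positivity
  have hL1 : 1 ≤ L := by nlinarith [sq_nonneg R₀]
  set R : ℝ := |R₀| + |R₁| + 2 * L * Real.exp (2 * Λ * (t₁ - t₀)) with hR
  have hE1 : 1 ≤ Real.exp (2 * Λ * (t₁ - t₀)) :=
    Real.one_le_exp (mul_nonneg (by positivity) (by linarith))
  have hR_exp : 2 * L * Real.exp (2 * Λ * (t₁ - t₀)) ≤ R := by
    rw [hR]; linarith [abs_nonneg R₀, abs_nonneg R₁]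
  have hR1 : 1 ≤ R := by nlinarith
  have hR₀R : R₀ ≤ R := by
    rw [hR]
    have : 0 ≤ 2 * L * Real.exp (2 * Λ * (t₁ - t₀)) := by positivity
    linarith [le_abs_self R₀, abs_nonneg R₁]
  have hR₁R : R₁ ≤ R := by
    rw [hR]
    have : 0 ≤ 2 * L * Real.exp (2 * Λ * (t₁ - t₀)) := by positivity
    linarith [le_abs_self R₁, abs_nonneg R₀]
  let q : ℝ × ℝ → ℝ := fun p => 2 - Real.exp (-(2 * Λ * (p.1 - t₀))) * (1 + p.2 ^ 2) / L
  let ψ : ℝ × ℝ → ℝ := fun p => Real.smoothTransition (q p)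
  have hψ : ContDiff ℝ (⊤ : ℕ∞) ψ := by
    refine Real.smoothTransition.contDiff.comp ?_
    simp only [q]
    fun_prop
  have hψR : ∀ t ∈ Icc t₀ t₁, ∀ y, y ^ 2 = R ^ 2 → ψ (t, y) = 0 := by
    intro t ht y hy
    refine Real.smoothTransition.zero_of_nonpos ?_
    have h1 : Real.exp (-(2 * Λ * (t₁ - t₀))) ≤ Real.exp (-(2 * Λ * (t - t₀))) := by
      apply Real.exp_le_exp.2
      nlinarith [ht.2]
    have h2 : Real.exp (-(2 * Λ * (t₁ - t₀))) * Real.exp (2 * Λ * (t₁ - t₀)) = 1 := by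
      rw [← Real.exp_add]; simp
    have h3 : 2 * L ≤ Real.exp (-(2 * Λ * (t - t₀))) * (1 + y ^ 2) := by
      calc 2 * L = Real.exp (-(2 * Λ * (t₁ - t₀))) * (2 * L * Real.exp (2 * Λ * (t₁ - t₀))) := by
            linear_combination (-(2 * L)) * h2
        _ ≤ Real.exp (-(2 * Λ * (t - t₀))) * (1 + y ^ 2) := by
            gcongr
            rw [hy]; nlinarith
    have h4 : 2 ≤ Real.exp (-(2 * Λ * (t - t₀))) * (1 + y ^ 2) / L := by
      rwa [le_div_iff₀ hLpos]
    simp only [q]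
    linarith
  let k : Set (ℝ × ℝ) := Icc (0 : ℝ) 1 ×ˢ Icc (-R) R
  have hk : IsCompact k := isCompact_Icc.prod isCompact_Icc
  let g : ℝ × ℝ × ℝ → ℝ := fun p => f p * ψ (p.1, p.2.2)
  have hψ3 : ContDiff ℝ (⊤ : ℕ∞) fun p : ℝ × ℝ × ℝ => ψ (p.1, p.2.2) := hψ.comp (by fun_prop)
  have hg : ContDiffOn ℝ (⊤ : ℕ∞) g (Ioo t₀ t₁ ×ˢ univ) := hf.mul hψ3.contDiffOn
  have hgc : ContinuousOn g (Icc t₀ t₁ ×ˢ univ) := hfc.mul hψ3.continuous.continuousOn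
  let M : ℝ → ℝ := fun t => ∫ x in k, g (t, x)
  have hderiv : ∀ t ∈ Ioo t₀ t₁,
      HasDerivAt M (∫ x in k, deriv (fun s => g (s, x)) t) t := fun t ht =>
    hasDerivAt_setIntegral_of_contDiffOn hg hk ht
  have hnonneg : ∀ t ∈ Ioo t₀ t₁, 0 ≤ ∫ x in k, deriv (fun s => g (s, x)) t := by
    intro t ht
    have htI := Ioo_subset_Icc_self ht
    have hgt : ContDiff ℝ (⊤ : ℕ∞) fun x => g (t, x) := hg.slice_right ht
    have hft : ContDiff ℝ (⊤ : ℕ∞) fun x => f (t, x) := hf.slice_right ht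
    have hfd := hft.differentiable (by simp)
    have hgd := hgt.differentiable (by simp)
    have hzero := setIntegral_hamiltonian_eq_zero (R := R) (by linarith) (hV t ht) hgt (hG t ht)
      (hVper t ht) (fun x => by simp [g, hfper]) (fun θ => by simp [g, hψR t htI R rfl])
      (fun θ => by simp [g, hψR t htI (-R) (by ring)])
    rw [← hzero]
    have hV' := (hV t ht).continuous_fderiv (by simp)
    have hg' := hgt.continuous_fderiv (by simp)
    have hGc := (hG t ht).continuous
    refine setIntegral_mono_on ?_ ?_ hk.measurableSet ?_
    · refine Continuous.continuousOn ?_ |>.integrableOn_compact hk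
      fun_prop
    · exact ((contDiffOn_deriv_fst hg).slice_right ht).continuous.continuousOn.integrableOn_compact hk
    · rintro ⟨θ, y⟩ ⟨hθ, hy⟩
      have hS := (Real.smoothTransition.contDiff (n := 1)).differentiable (by simp) (q (t, y))
      set S := deriv Real.smoothTransition (q (t, y)) with hSdef
      have hS0 : 0 ≤ S := Real.smoothTransition.monotone.deriv_nonneg
      set e := Real.exp (-(2 * Λ * (t - t₀))) with he
      have dψt : HasDerivAt (fun s => ψ (s, y)) (S * (2 * Λ * e * (1 + y ^ 2) / L)) t := by
        have h1 : HasDerivAt (fun s => q (s, y)) (2 * Λ * e * (1 + y ^ 2) / L) t := by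
          have := ((((((hasDerivAt_id t).sub_const t₀).const_mul (2 * Λ)).neg.exp).mul_const
            (1 + y ^ 2)).div_const L).const_sub 2
          refine this.congr_deriv ?_
          simp [he]; ring
        exact hS.hasDerivAt.comp t h1
      have dψy : HasDerivAt (fun z => ψ (t, z)) (S * (-(e * (2 * y) / L))) y := by
        have h1 : HasDerivAt (fun z => q (t, z)) (-(e * (2 * y) / L)) y := by
          have := (((((hasDerivAt_id y).pow 2).const_add 1).const_mul e).div_const L).const_sub 2
          refine this.congr_deriv ?_
          simp
        exact hS.hasDerivAt.comp y h1
      have dft : HasDerivAt (fun s => f (s, θ, y)) (deriv (fun s => f (s, θ, y)) t) t :=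
        (hasDerivAt_fst_of_contDiffOn hf ht (θ, y)).differentiableAt.hasDerivAt
      have dgt : deriv (fun s => g (s, θ, y)) t = _ := (dft.mul dψt).deriv
      have dfy : HasDerivAt (fun z => f (t, θ, z)) (fderiv ℝ (fun x => f (t, x)) (θ, y) (0, 1)) y := by
        rw [fderiv_apply_zero_one (hfd _)]
        exact (hft.comp (contDiff_prodMk_right θ)).differentiable (by simp) y |>.hasDerivAt
      have dfθ : HasDerivAt (fun z => f (t, z, y)) (fderiv ℝ (fun x => f (t, x)) (θ, y) (1, 0)) θ := by
        rw [fderiv_apply_one_zero (hfd _)]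
        exact (hft.comp (contDiff_prodMk_left y)).differentiable (by simp) θ |>.hasDerivAt
      have dgy : fderiv ℝ (fun x => g (t, x)) (θ, y) (0, 1)
          = fderiv ℝ (fun x => f (t, x)) (θ, y) (0, 1) * ψ (t, y)
            + f (t, θ, y) * (S * (-(e * (2 * y) / L))) := by
        rw [fderiv_apply_zero_one (hgd _)]
        exact (dfy.mul dψy).deriv
      have dgθ : fderiv ℝ (fun x => g (t, x)) (θ, y) (1, 0)
          = fderiv ℝ (fun x => f (t, x)) (θ, y) (1, 0) * ψ (t, y) := by
        rw [fderiv_apply_one_zero (hgd _)]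
        exact (dfθ.mul_const (ψ (t, y))).deriv
      rw [dgt, dgy, dgθ, heq t ht (θ, y)]
      have hb := hgrow t ht θ hθ y
      set F := fderiv ℝ (V t) (θ, y) (1, 0) + G t θ with hF
      have h5 : 0 ≤ f (t, θ, y) * (S * (e / L) * (2 * (Λ * (1 + y ^ 2) - y * F))) := by
        have := hfnn t htI (θ, y)
        have h6 : 0 ≤ Λ * (1 + y ^ 2) - y * F := by linarith [le_abs_self (y * F)]
        positivity
      rw [← sub_nonneg]
      refine h5.trans_eq ?_
      ring
  have hmono : M t₀ ≤ M t₁ := by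
    refine monotoneOn_of_deriv_nonneg (convex_Icc t₀ t₁)
      (continuousOn_setIntegral isCompact_Icc hgc hk) ?_ ?_ (left_mem_Icc.2 hlt.le)
      (right_mem_Icc.2 hlt.le) hlt.le
    · rw [interior_Icc]
      exact fun t ht => (hderiv t ht).differentiableAt.differentiableWithinAt
    · rw [interior_Icc]
      exact fun t ht => (hderiv t ht).deriv ▸ hnonneg t ht
  have hrestrict : ∀ t, (∀ θ y, R < |y| → f (t, θ, y) = 0) →
      ∫ x in Icc (0 : ℝ) 1 ×ˢ univ, f (t, x) = ∫ x in k, f (t, x) := by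
    intro t ht
    refine setIntegral_eq_of_subset_of_forall_sdiff_eq_zero
      (measurableSet_Icc.prod MeasurableSet.univ) (prod_mono Subset.rfl (subset_univ _)) ?_
    rintro ⟨θ, y⟩ ⟨⟨hθ, -⟩, hx⟩
    refine ht θ y ?_
    by_contra! hy
    exact hx ⟨hθ, abs_le.1 hy⟩
  rw [hrestrict t₀ fun θ y hy => hR₀ θ y (hR₀R.trans_lt hy),
    hrestrict t₁ fun θ y hy => hR₁ θ y (hR₁R.trans_lt hy)]
  have hM₀ : ∫ x in k, f (t₀, x) = M t₀ := by
    refine setIntegral_congr_fun hk.measurableSet ?_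
    rintro ⟨θ, y⟩ -
    rcases lt_or_ge R₀ |y| with hy | hy
    · simp [g, hR₀ θ y hy]
    · have : ψ (t₀, y) = 1 := by
        refine Real.smoothTransition.one_of_one_le ?_
        have h1 : y ^ 2 ≤ R₀ ^ 2 := by
          rw [← sq_abs y]; exact pow_le_pow_left₀ (abs_nonneg y) hy 2
        have h2 : (1 + y ^ 2) / L ≤ 1 := by rw [div_le_one hLpos]; linarith
        simp only [q, sub_self, mul_zero, neg_zero, Real.exp_zero, one_mul]
        linarith
      simp [g, this]
  have hM₁ : M t₁ ≤ ∫ x in k, f (t₁, x) := by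
    have hc : ∀ F : ℝ × ℝ × ℝ → ℝ, ContinuousOn F (Icc t₀ t₁ ×ˢ univ) →
        IntegrableOn (fun x => F (t₁, x)) k := fun F hF =>
      (hF.comp_continuous (f := fun x => (t₁, x)) (by fun_prop)
        fun x => ⟨right_mem_Icc.2 hlt.le, mem_univ _⟩).continuousOn.integrableOn_compact hk
    refine setIntegral_mono_on (hc g hgc) (hc f hfc) hk.measurableSet fun x _ => ?_
    exact mul_le_of_le_one_right (hfnn t₁ (right_mem_Icc.2 hlt.le) x)
      (Real.smoothTransition.le_one _)
  linarith

lemma integrable_cylinder {F : ℝ × V3 → ℝ} (hF : Continuous F)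
    (hsupp : ∃ R : ℝ, ∀ θ v, R < ‖v‖ → F (θ, v) = 0) :
    Integrable F ((volume.restrict (Icc (0 : ℝ) 1)).prod volume) := by
  obtain ⟨R, hR⟩ := hsupp
  have h1 : IntegrableOn F (Icc (0 : ℝ) 1 ×ˢ Metric.closedBall (0 : V3) R) :=
    hF.continuousOn.integrableOn_compact (isCompact_Icc.prod (isCompact_closedBall _ _))
  have h2 : IntegrableOn F (Icc (0 : ℝ) 1 ×ˢ univ) := by
    refine h1.of_forall_sdiff_eq_zero (measurableSet_Icc.prod MeasurableSet.univ) ?_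
    rintro ⟨θ, v⟩ ⟨⟨hθ, -⟩, hv⟩
    refine hR θ v ?_
    by_contra! h
    exact hv ⟨hθ, by simpa using h⟩
  have h3 := Measure.prod_restrict (μ := (volume : Measure ℝ)) (ν := (volume : Measure V3))
    (Icc (0 : ℝ) 1) univ
  rw [Measure.restrict_univ] at h3
  rw [h3]
  exact h2

lemma integral_cylinder_weight {F : ℝ × V3 → ℝ} (hF : Continuous F)
    (hsupp : ∃ R : ℝ, ∀ θ v, R < ‖v‖ → F (θ, v) = 0) {φ : ℝ × ℝ → ℝ} (hφ : Continuous φ) :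
    Integrable (fun w => φ w * ∫ x in Icc (0 : ℝ) 1 ×ˢ univ, F (x.1, x.2, w)) ∧
    ∫ θ in Icc (0 : ℝ) 1, ∫ v : V3, F (θ, v) * φ v.2
      = ∫ w, φ w * ∫ x in Icc (0 : ℝ) 1 ×ˢ univ, F (x.1, x.2, w) := by
  set μ := volume.restrict (Icc (0 : ℝ) 1) with hμ
  have hint : Integrable (fun p : ℝ × V3 => F p * φ p.2.2) (μ.prod volume) := by
    refine integrable_cylinder (by fun_prop) ?_
    obtain ⟨R, hR⟩ := hsupp
    exact ⟨R, fun θ v hv => by simp [hR θ v hv]⟩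
  have h3 : μ.prod (volume : Measure ℝ) = volume.restrict (Icc (0 : ℝ) 1 ×ˢ univ) := by
    rw [Measure.volume_eq_prod, ← Measure.prod_restrict, Measure.restrict_univ]
  have hmp := measurePreserving_prodAssoc μ (volume : Measure ℝ) (volume : Measure (ℝ × ℝ))
  have hint' := (hmp.integrable_comp_emb MeasurableEquiv.prodAssoc.measurableEmbedding).2 hint
  have hslice : ∀ w, ∫ x, F (x.1, x.2, w) * φ w ∂(μ.prod (volume : Measure ℝ))
      = φ w * ∫ x in Icc (0 : ℝ) 1 ×ˢ univ, F (x.1, x.2, w) := by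
    intro w
    rw [integral_mul_const, mul_comm, h3]
  constructor
  · have := hint'.integral_prod_right
    simp_rw [← hslice]
    exact this
  · rw [← integral_prod (fun p : ℝ × V3 => F p * φ p.2.2) hint]
    have e := hmp.integral_comp' (fun p : ℝ × V3 => F p * φ p.2.2)
    rw [Measure.volume_eq_prod] at hint ⊢
    exact e.symm.trans ((integral_prod_symm _ hint').trans
      (integral_congr_ae (Filter.Eventually.of_forall hslice)))

lemma deriv_neg_sqrt_growth {s : Set ℝ} (hs : UniqueDiffOn ℝ s) {c d : ℝ} (hcd : Icc c d ⊆ s)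
    {a b G : ℝ × ℝ → ℝ} (ha : ContDiffOn ℝ (⊤ : ℕ∞) a (s ×ˢ univ))
    (hb : ContDiffOn ℝ (⊤ : ℕ∞) b (s ×ˢ univ)) (hG : ContDiffOn ℝ (⊤ : ℕ∞) G (s ×ˢ univ))
    (hapos : ∀ t ∈ s, ∀ θ, 0 < a (t, θ)) (hbpos : ∀ t ∈ s, ∀ θ, 0 < b (t, θ)) :
    ∃ Λ, 0 ≤ Λ ∧ ∀ t ∈ Icc c d, ∀ θ ∈ Icc (0 : ℝ) 1, ∀ y,
      |y * (deriv (fun x => -√(a (t, x) + b (t, x) * y ^ 2)) θ + G (t, θ))| ≤ Λ * (1 + y ^ 2) := by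
  set a' : ℝ × ℝ → ℝ := fun p => deriv (fun x => a (p.1, x)) p.2 with ha'
  set b' : ℝ × ℝ → ℝ := fun p => deriv (fun x => b (p.1, x)) p.2 with hb'
  have ca := (contDiffOn_deriv_snd hs ha).continuousOn
  have cb := (contDiffOn_deriv_snd hs hb).continuousOn
  have hbd : ContinuousOn (fun p => (|a' p| + |b' p|) / (2 * √(b p)) + |G p|) (s ×ˢ univ) := by
    refine ((ca.abs.add cb.abs).div (continuousOn_const.mul hb.continuousOn.sqrt) ?_).add
      hG.continuousOn.abs
    rintro ⟨t, θ⟩ ⟨ht, -⟩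
    exact (mul_pos two_pos (Real.sqrt_pos.2 (hbpos t ht θ))).ne'
  obtain ⟨C, hC⟩ := ((isCompact_Icc (a := c) (b := d)).prod (isCompact_Icc (a := (0 : ℝ)) (b := 1))
    ).exists_bound_of_continuousOn (hbd.mono (prod_mono hcd (subset_univ _)))
  refine ⟨|C|, abs_nonneg C, fun t ht θ hθ y => ?_⟩
  have hts := hcd ht
  have hC' := (le_abs_self _).trans ((hC (t, θ) ⟨ht, hθ⟩).trans (le_abs_self C))
  have hap := hapos t hts θ
  have hbp := hbpos t hts θ
  have da : HasDerivAt (fun x => a (t, x)) (a' (t, θ)) θ :=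
    ((ha.slice_right hts).differentiable (by simp) θ).hasDerivAt
  have db : HasDerivAt (fun x => b (t, x)) (b' (t, θ)) θ :=
    ((hb.slice_right hts).differentiable (by simp) θ).hasDerivAt
  have hQ : 0 < a (t, θ) + b (t, θ) * y ^ 2 := by positivity
  have dV := ((da.add (db.mul_const (y ^ 2))).sqrt hQ.ne').neg.deriv
  change deriv (fun x => -√(a (t, x) + b (t, x) * y ^ 2)) θ = _ at dV
  rw [dV]
  set r := √(b (t, θ)) with hr
  have hr0 : 0 < r := Real.sqrt_pos.2 hbp
  change |y * (-((a' (t, θ) + b' (t, θ) * y ^ 2) / (2 * √(a (t, θ) + b (t, θ) * y ^ 2)))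
    + G (t, θ))| ≤ _
  set q := √(a (t, θ) + b (t, θ) * y ^ 2) with hq
  have hq0 : 0 < q := Real.sqrt_pos.2 hQ
  have hrq : r * |y| ≤ q := by
    rw [hq, hr, ← Real.sqrt_sq_eq_abs, ← Real.sqrt_mul hbp.le]
    exact Real.sqrt_le_sqrt (by linarith)
  have h1 : |y| / (2 * q) ≤ 1 / (2 * r) := by
    rw [div_le_div_iff₀ (by positivity) (by positivity)]
    linarith
  have hy : |y| ≤ 1 + y ^ 2 := by
    rw [← sq_abs]; nlinarith [sq_nonneg (|y| - 1)]
  have h2 : |a' (t, θ) + b' (t, θ) * y ^ 2| ≤ (|a' (t, θ)| + |b' (t, θ)|) * (1 + y ^ 2) := by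
    refine (abs_add_le _ _).trans ?_
    rw [abs_mul, abs_of_nonneg (sq_nonneg y)]
    nlinarith [abs_nonneg (a' (t, θ)), abs_nonneg (b' (t, θ)), sq_nonneg y,
      mul_nonneg (abs_nonneg (a' (t, θ))) (sq_nonneg y)]
  calc |y * (-((a' (t, θ) + b' (t, θ) * y ^ 2) / (2 * q)) + G (t, θ))|
      ≤ |y| * (|a' (t, θ) + b' (t, θ) * y ^ 2| / (2 * q) + |G (t, θ)|) := by
        rw [abs_mul]
        refine mul_le_mul_of_nonneg_left ((abs_add_le _ _).trans ?_) (abs_nonneg y)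
        rw [abs_neg, abs_div, abs_of_pos (show 0 < 2 * q by positivity)]
    _ = |a' (t, θ) + b' (t, θ) * y ^ 2| * (|y| / (2 * q)) + |G (t, θ)| * |y| := by ring
    _ ≤ ((|a' (t, θ)| + |b' (t, θ)|) * (1 + y ^ 2)) * (1 / (2 * r))
        + |G (t, θ)| * (1 + y ^ 2) := by gcongr
    _ = ((|a' (t, θ)| + |b' (t, θ)|) / (2 * r) + |G (t, θ)|) * (1 + y ^ 2) := by ring
    _ ≤ |C| * (1 + y ^ 2) := by gcongr

/-- Weighted number of particles, for weights depending on the conserved momenta only. -/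
lemma weighted_particle_number_le
    {tp ti : ℝ} (htp : 0 < tp)
    {U A ν α J K : ℝ → ℝ → ℝ} {f : ℝ → ℝ → V3 → ℝ}
    (hUsm : ContDiffOn ℝ (⊤ : ℕ∞) (fun p : ℝ × ℝ => U p.1 p.2) (Ioc tp ti ×ˢ (univ : Set ℝ)))
    (hAsm : ContDiffOn ℝ (⊤ : ℕ∞) (fun p : ℝ × ℝ => A p.1 p.2) (Ioc tp ti ×ˢ (univ : Set ℝ)))
    (hνsm : ContDiffOn ℝ (⊤ : ℕ∞) (fun p : ℝ × ℝ => ν p.1 p.2) (Ioc tp ti ×ˢ (univ : Set ℝ)))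
    (hαsm : ContDiffOn ℝ (⊤ : ℕ∞) (fun p : ℝ × ℝ => α p.1 p.2) (Ioc tp ti ×ˢ (univ : Set ℝ)))
    (hJsm : ContDiffOn ℝ (⊤ : ℕ∞) (fun p : ℝ × ℝ => J p.1 p.2) (Ioc tp ti ×ˢ (univ : Set ℝ)))
    (hKsm : ContDiffOn ℝ (⊤ : ℕ∞) (fun p : ℝ × ℝ => K p.1 p.2) (Ioc tp ti ×ˢ (univ : Set ℝ)))
    (hfsm : ContDiffOn ℝ (⊤ : ℕ∞) (fun p : ℝ × ℝ × V3 => f p.1 p.2.1 p.2.2)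
      (Ioc tp ti ×ˢ (univ : Set (ℝ × V3))))
    (hUper : ∀ t θ, U t (θ + 1) = U t θ)
    (hAper : ∀ t θ, A t (θ + 1) = A t θ)
    (hνper : ∀ t θ, ν t (θ + 1) = ν t θ)
    (hαper : ∀ t θ, α t (θ + 1) = α t θ)
    (hfper : ∀ t θ v, f t (θ + 1) v = f t θ v)
    (hαpos : ∀ t ∈ Ioc tp ti, ∀ θ : ℝ, 0 < α t θ)
    (hfnn : ∀ t ∈ Ioc tp ti, ∀ (θ : ℝ) (v : V3), 0 ≤ f t θ v)
    (hfsupp : ∀ t ∈ Ioc tp ti, ∃ R : ℝ, ∀ (θ : ℝ) (v : V3), R < ‖v‖ → f t θ v = 0)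
    (hvlasov :
      ∀ t ∈ Ioc tp ti, ∀ (θ : ℝ) (v : V3),
      ptf f t θ v
        = pv1 (v0 α ν U A t θ) v * pθf f t θ v
          - (deriv (fun x => v0 α ν U A t x v) θ
              + Real.sqrt (α t θ) * Real.exp (2 * ν t θ) / t ^ 3 * (K t θ - A t θ * J t θ)
                * (v.2.2 - A t θ * v.2.1)
              + Real.sqrt (α t θ) * Real.exp (2 * ν t θ - 4 * U t θ) / t * J t θ * v.2.1)
            * pv1 (f t θ) v)
    {φ : ℝ × ℝ → ℝ} (hφ : Continuous φ) (hφ0 : ∀ w, 0 ≤ φ w) {t₀ : ℝ} (ht₀ : t₀ ∈ Ioc tp ti) :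
    ∫ θ in Icc (0 : ℝ) 1, ∫ v : V3, f t₀ θ v * φ v.2
      ≤ ∫ θ in Icc (0 : ℝ) 1, ∫ v : V3, f ti θ v * φ v.2 := by
  rcases ht₀.2.eq_or_lt with rfl | hlt
  · exact le_rfl
  have hti : ti ∈ Ioc tp ti := ⟨ht₀.1.trans hlt, le_rfl⟩
  have hsub : Icc t₀ ti ⊆ Ioc tp ti := fun t ht => ⟨ht₀.1.trans_le ht.1, ht.2⟩
  have hsub' : Ioo t₀ ti ⊆ Ioc tp ti := Ioo_subset_Icc_self.trans hsub
  have hfs : ∀ t ∈ Ioc tp ti, Continuous fun p : ℝ × V3 => f t p.1 p.2 := fun t ht =>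
    (hfsm.slice_right ht).continuous
  obtain ⟨i₀, e₀⟩ := integral_cylinder_weight (hfs t₀ ht₀) (hfsupp t₀ ht₀) hφ
  obtain ⟨i₁, e₁⟩ := integral_cylinder_weight (hfs ti hti) (hfsupp ti hti) hφ
  simp only at e₀ e₁
  rw [e₀, e₁]
  refine integral_mono i₀ i₁ fun w => mul_le_mul_of_nonneg_left ?_ (hφ0 w)
  have cfst : ContDiffOn ℝ (⊤ : ℕ∞) (fun p : ℝ × ℝ => p.1) (Ioc tp ti ×ˢ (univ : Set ℝ)) :=
    contDiffOn_fst
  have hpos : ∀ t ∈ Ioc tp ti, 0 < t := fun t ht => htp.trans ht.1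
  let a : ℝ × ℝ → ℝ := fun p => α p.1 p.2 * Real.exp (2 * ν p.1 p.2 - 2 * U p.1 p.2)
    + α p.1 p.2 * Real.exp (2 * ν p.1 p.2 - 4 * U p.1 p.2) * w.1 ^ 2
    + α p.1 p.2 * (p.1 ^ 2)⁻¹ * Real.exp (2 * ν p.1 p.2) * (w.2 - A p.1 p.2 * w.1) ^ 2
  let b : ℝ × ℝ → ℝ := fun p => α p.1 p.2
  let G : ℝ × ℝ → ℝ := fun p => √(α p.1 p.2) * Real.exp (2 * ν p.1 p.2) / p.1 ^ 3
      * (K p.1 p.2 - A p.1 p.2 * J p.1 p.2) * (w.2 - A p.1 p.2 * w.1)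
    + √(α p.1 p.2) * Real.exp (2 * ν p.1 p.2 - 4 * U p.1 p.2) / p.1 * J p.1 p.2 * w.1
  have hsm : UniqueDiffOn ℝ (Ioc tp ti) := uniqueDiffOn_Ioc tp ti
  have e2ν := (contDiffOn_const (c := (2 : ℝ))).mul hνsm
  have e4U := (contDiffOn_const (c := (4 : ℝ))).mul hUsm
  have e2U := (contDiffOn_const (c := (2 : ℝ))).mul hUsm
  have hAv := (contDiffOn_const (c := w.2)).sub (hAsm.mul (contDiffOn_const (c := w.1)))
  have hsq := hαsm.sqrt fun p hp => (hαpos p.1 hp.1 p.2).ne'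
  have ha : ContDiffOn ℝ (⊤ : ℕ∞) a (Ioc tp ti ×ˢ univ) :=
    ((hαsm.mul (e2ν.sub e2U).exp).add ((hαsm.mul (e2ν.sub e4U).exp).mul contDiffOn_const)).add
      (((hαsm.mul ((cfst.pow 2).inv fun p hp => (pow_pos (hpos p.1 hp.1) 2).ne')).mul e2ν.exp).mul
        (hAv.pow 2))
  have hb : ContDiffOn ℝ (⊤ : ℕ∞) b (Ioc tp ti ×ˢ univ) := hαsm
  have hG : ContDiffOn ℝ (⊤ : ℕ∞) G (Ioc tp ti ×ˢ univ) :=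
    ((((hsq.mul e2ν.exp).div (cfst.pow 3) fun p hp => (pow_pos (hpos p.1 hp.1) 3).ne').mul
      (hKsm.sub (hAsm.mul hJsm))).mul hAv).add
      ((((hsq.mul (e2ν.sub e4U).exp).div cfst fun p hp => (hpos p.1 hp.1).ne').mul hJsm).mul
        contDiffOn_const)
  have hapos : ∀ t ∈ Ioc tp ti, ∀ θ, 0 < a (t, θ) := by
    intro t ht θ
    have := hαpos t ht θ
    have := hpos t ht
    simp only [a]
    positivity
  have hv0 : ∀ (t : ℝ) (x : ℝ × ℝ), v0 α ν U A t x.1 (x.2, w) = -√(a (t, x.1) + b (t, x.1) * x.2 ^ 2) := by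
    intro t x
    simp only [v0, a, b]
    congr 2
    ring
  have hV : ∀ t ∈ Ioc tp ti,
      ContDiff ℝ (⊤ : ℕ∞) fun x : ℝ × ℝ => v0 α ν U A t x.1 (x.2, w) := by
    intro t ht
    simp_rw [hv0]
    refine (((ha.slice_right ht).comp contDiff_fst).add
      (((hb.slice_right ht).comp contDiff_fst).mul (contDiff_snd.pow 2))).sqrt ?_ |>.neg
    intro x
    have := hapos t ht x.1
    have := hαpos t ht x.1
    simp only [Function.comp, b]
    positivity
  obtain ⟨Λ, hΛ, hgrow⟩ := deriv_neg_sqrt_growth hsm hsub ha hb hG hapos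
    (fun t ht θ => hαpos t ht θ)
  have hfw : ContDiffOn ℝ (⊤ : ℕ∞) (fun p : ℝ × ℝ × ℝ => f p.1 p.2.1 (p.2.2, w))
      (Ioc tp ti ×ˢ univ) :=
    hfsm.comp (f := fun p : ℝ × ℝ × ℝ => (p.1, p.2.1, (p.2.2, w)))
      (ContDiff.contDiffOn (by fun_prop)) fun p hp => ⟨hp.1, mem_univ _⟩
  have hsuppw : ∀ t ∈ Ioc tp ti, ∃ R, ∀ θ y, R < |y| → f t θ (y, w) = 0 := by
    intro t ht
    obtain ⟨R, hR⟩ := hfsupp t ht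
    exact ⟨R, fun θ y hy => hR θ _ (hy.trans_le (norm_fst_le (y, w)))⟩
  refine setIntegral_le_of_hamiltonian_transport hlt hΛ
    (V := fun t x => v0 α ν U A t x.1 (x.2, w)) (G := fun t θ => G (t, θ))
    (f := fun p => f p.1 p.2.1 (p.2.2, w))
    (fun t ht => hV t (hsub' ht)) ?_ (fun t ht => hG.slice_right (hsub' ht))
    (hfw.mono (prod_mono hsub' Subset.rfl)) (hfw.continuousOn.mono (prod_mono hsub Subset.rfl))
    ?_ (fun t ht x => hfnn t (hsub ht) _ _) (hsuppw t₀ ht₀) (hsuppw ti hti) ?_ ?_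
  · intro t _ x
    simp [v0, hαper, hνper, hUper, hAper]
  · intro t x
    simp [hfper]
  · intro t ht θ hθ y
    rw [fderiv_apply_one_zero ((hV t (hsub' ht)).differentiable (by simp) _)]
    have := hgrow t (Ioo_subset_Icc_self ht) θ hθ y
    rwa [← funext fun x => hv0 t (x, y)] at this
  · intro t ht x
    have hft := (hfw.slice_right (hsub' ht)).differentiable (by simp)
    have hVt := (hV t (hsub' ht)).differentiable (by simp)
    rw [fderiv_apply_one_zero (hVt x), fderiv_apply_zero_one (hVt x),
      fderiv_apply_one_zero (hft x), fderiv_apply_zero_one (hft x)]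
    have := hvlasov t (hsub' ht) x.1 (x.2, w)
    rw [add_assoc] at this
    exact this

lemma sub_le_integral_abs_deriv {g : ℝ → ℝ} (hg : ContDiff ℝ (⊤ : ℕ∞) g) {x y : ℝ}
    (hx : x ∈ Icc (0 : ℝ) 1) (hy : y ∈ Icc (0 : ℝ) 1) :
    g x - g y ≤ ∫ θ in (0 : ℝ)..1, |deriv g θ| := by
  have hc : Continuous (deriv g) := hg.continuous_deriv (by simp)
  rw [← intervalIntegral.integral_deriv_eq_sub' (f := g) (a := y) (b := x) rfl
    (fun z _ => hg.differentiable (by simp) z) hc.continuousOn]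
  have h := intervalIntegral.norm_integral_le_integral_norm_uIoc (f := deriv g) (a := y) (b := x)
    (μ := volume)
  simp only [Real.norm_eq_abs] at h
  refine (le_abs_self _).trans (h.trans ?_)
  rw [intervalIntegral.integral_of_le zero_le_one]
  refine setIntegral_mono_set ?_ ?_ (LE.le.eventuallyLE ?_)
  · exact (hc.abs.intervalIntegrable 0 1).1
  · exact Filter.Eventually.of_forall fun z => abs_nonneg _
  · exact Ioc_subset_Ioc (le_min hy.1 hx.1) (max_le hy.2 hx.2)

lemma bounded_of_logarithmic_decay {a b : ℝ} (ha : 0 < a) (hab : a < b) {E E' : ℝ → ℝ}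
    (hE : ∀ t ∈ Ioo a b, HasDerivAt E (E' t) t) (hE0 : ∀ t ∈ Ioo a b, 0 ≤ E t)
    (hle : ∀ t ∈ Ioo a b, E' t ≤ 0) (hge : ∀ t ∈ Ioo a b, -(4 * E t / t) ≤ E' t) :
    ∃ B, ∀ t ∈ Ioo a b, E t ≤ B := by
  set m := (a + b) / 2 with hm
  have hmI : m ∈ Ioo a b := ⟨by linarith, by linarith⟩
  have hanti : AntitoneOn E (Ioo a b) := by
    refine antitoneOn_of_deriv_nonpos (convex_Ioo a b)
      (fun t ht => (hE t ht).continuousAt.continuousWithinAt) ?_ ?_ <;> rw [interior_Ioo]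
    · exact fun t ht => (hE t ht).differentiableAt.differentiableWithinAt
    · exact fun t ht => (hE t ht).deriv ▸ hle t ht
  have hd : ∀ t ∈ Ioo a b, HasDerivAt (fun t => t ^ 4 * E t) (4 * t ^ 3 * E t + t ^ 4 * E' t) t :=
    fun t ht => ((hasDerivAt_pow 4 t).mul (hE t ht)).congr_deriv (by simp)
  have hmono : MonotoneOn (fun t => t ^ 4 * E t) (Ioo a b) := by
    refine monotoneOn_of_deriv_nonneg (convex_Ioo a b)
      (fun t ht => (hd t ht).continuousAt.continuousWithinAt) ?_ ?_ <;> rw [interior_Ioo]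
    · exact fun t ht => (hd t ht).differentiableAt.differentiableWithinAt
    · intro t ht
      rw [(hd t ht).deriv]
      have ht0 : 0 < t := ha.trans ht.1
      have h1 := mul_le_mul_of_nonneg_left (hge t ht) (pow_pos ht0 4).le
      have h2 : t ^ 4 * -(4 * E t / t) = -(4 * t ^ 3 * E t) := by field_simp
      linarith
  refine ⟨m ^ 4 * E m / a ^ 4 + E m, fun t ht => ?_⟩
  have hm0 := hE0 m hmI
  have ht0 : 0 < t := ha.trans ht.1
  rcases le_total t m with h | h
  · have h1 : t ^ 4 * E t ≤ m ^ 4 * E m := hmono ht hmI h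
    have h2 : a ^ 4 * E t ≤ t ^ 4 * E t :=
      mul_le_mul_of_nonneg_right (pow_le_pow_left₀ ha.le ht.1.le 4) (hE0 t ht)
    have h3 : E t ≤ m ^ 4 * E m / a ^ 4 := by
      rw [le_div_iff₀ (by positivity)]
      linarith
    linarith
  · have h1 := hanti hmI ht h
    have : 0 ≤ m ^ 4 * E m / a ^ 4 := by positivity
    linarith

/-- The evolution identity behind the energy `Etilde`: up to a divergence, its density changes only
through the lower order terms. -/
lemma deriv_energy_density_sub_divergence {s t N N' α₁ α₂ αt ν₁ ν₂ X : ℝ} (hs : 0 < s) (ht : 0 < t)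
    (hN : N' = s ^ 2 * ν₂ + αt * N / (2 * s ^ 2) + α₁ * ν₁ / 2 + α₂ / 2 - α₁ ^ 2 / (4 * s ^ 2) + X) :
    (N' * (s * t) - N * (αt / (2 * s) * t + s)) / (s * t) ^ 2
      - (α₁ / (2 * s) * ν₁ + s * ν₂ + (α₂ * (2 * s) - α₁ * (2 * (α₁ / (2 * s)))) / (2 * s) ^ 2) / t
      = (X - N / t) / (s * t) := by
  subst hN
  field_simp
  ring

section Matter

variable {α ν U A : ℝ → ℝ → ℝ} {t θ : ℝ} {g : V3 → ℝ}

lemma continuous_v0 (α ν U A : ℝ → ℝ → ℝ) (t θ : ℝ) : Continuous (v0 α ν U A t θ) := by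
  unfold v0
  fun_prop

lemma integrable_mul_of_bounded_support (hg : Continuous g)
    (hsupp : ∃ R : ℝ, ∀ v, R < ‖v‖ → g v = 0) {h : V3 → ℝ} (hh : Continuous h) :
    Integrable fun v => g v * h v := by
  obtain ⟨R, hR⟩ := hsupp
  refine (hg.mul hh).integrable_of_hasCompactSupport
    (HasCompactSupport.intro (isCompact_closedBall 0 R) fun v hv => ?_)
  simp only [Metric.mem_closedBall, dist_zero_right, not_le] at hv
  simp [hR v hv]

lemma sq_v0 (hα : 0 < α t θ) (v : V3) : v0 α ν U A t θ v ^ 2 =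
    α t θ * Real.exp (2 * ν t θ - 2 * U t θ) + α t θ * v.1 ^ 2
    + α t θ * Real.exp (2 * ν t θ - 4 * U t θ) * v.2.1 ^ 2
    + α t θ * (t ^ 2)⁻¹ * Real.exp (2 * ν t θ) * (v.2.2 - A t θ * v.2.1) ^ 2 := by
  rw [v0, neg_sq, Real.sq_sqrt (by positivity)]

lemma abs_momentum_le (hα : 0 < α t θ) (hg : Continuous g) (hg0 : ∀ v, 0 ≤ g v)
    (hsupp : ∃ R : ℝ, ∀ v, R < ‖v‖ → g v = 0) :
    |√(α t θ) * ∫ v, g v * v.1| ≤ ∫ v, g v * |v0 α ν U A t θ v| := by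
  rw [← integral_const_mul (√(α t θ)) fun v : V3 => g v * v.1, ← Real.norm_eq_abs]
  refine norm_integral_le_of_norm_le
    (integrable_mul_of_bounded_support hg hsupp (continuous_v0 α ν U A t θ).abs)
    (Filter.Eventually.of_forall fun v => ?_)
  rw [Real.norm_eq_abs, abs_mul, abs_mul, abs_of_nonneg (hg0 v), mul_left_comm]
  refine mul_le_mul_of_nonneg_left ?_ (hg0 v)
  rw [← abs_mul]
  refine sq_le_sq.1 ?_
  rw [sq_v0 hα, mul_pow, Real.sq_sqrt hα.le]
  have : 0 ≤ α t θ * Real.exp (2 * ν t θ - 2 * U t θ) := by positivity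
  have : 0 ≤ α t θ * Real.exp (2 * ν t θ - 4 * U t θ) * v.2.1 ^ 2 := by positivity
  have : 0 ≤ α t θ * (t ^ 2)⁻¹ * Real.exp (2 * ν t θ) * (v.2.2 - A t θ * v.2.1) ^ 2 := by positivity
  linarith

lemma pressure_le (hα : 0 < α t θ) (hg : Continuous g) (hg0 : ∀ v, 0 ≤ g v)
    (hsupp : ∃ R : ℝ, ∀ v, R < ‖v‖ → g v = 0) :
    α t θ * (t ^ 2)⁻¹ * Real.exp (2 * ν t θ)
        * ∫ v, g v * (v.2.2 - A t θ * v.2.1) ^ 2 / |v0 α ν U A t θ v|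
      ≤ ∫ v, g v * |v0 α ν U A t θ v| := by
  rw [← integral_const_mul]
  refine integral_mono_of_nonneg (Filter.Eventually.of_forall fun v => ?_)
    (integrable_mul_of_bounded_support hg hsupp (continuous_v0 α ν U A t θ).abs)
    (Filter.Eventually.of_forall fun v => ?_)
  · have := hg0 v
    simp only [Pi.zero_apply]
    positivity
  · have e := sq_v0 (ν := ν) (U := U) (A := A) hα v
    have h1 : 0 < α t θ * Real.exp (2 * ν t θ - 2 * U t θ) := by positivity
    have h2 : 0 ≤ α t θ * v.1 ^ 2 := by positivity
    have h3 : 0 ≤ α t θ * Real.exp (2 * ν t θ - 4 * U t θ) * v.2.1 ^ 2 := by positivity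
    have h4 : 0 ≤ α t θ * (t ^ 2)⁻¹ * Real.exp (2 * ν t θ) * (v.2.2 - A t θ * v.2.1) ^ 2 := by
      positivity
    rw [← sq_abs] at e
    have hpos : 0 < |v0 α ν U A t θ v| := by
      rcases (abs_nonneg (v0 α ν U A t θ v)).eq_or_lt with h | h
      · rw [← h] at e; linarith
      · exact h
    change _ * (g v * _ / _) ≤ _
    rw [← mul_div_assoc, div_le_iff₀ hpos]
    calc _ = g v * (α t θ * (t ^ 2)⁻¹ * Real.exp (2 * ν t θ) * (v.2.2 - A t θ * v.2.1) ^ 2) := by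
          ring
      _ ≤ g v * |v0 α ν U A t θ v| ^ 2 := mul_le_mul_of_nonneg_left (by linarith) (hg0 v)
      _ = _ := by ring

end Matter

section Energy

variable {tp ti : ℝ} {ν α X : ℝ → ℝ → ℝ}

lemma contDiff_pθ {F : ℝ → ℝ → ℝ} {t : ℝ} (hF : ContDiff ℝ (⊤ : ℕ∞) (F t)) :
    ContDiff ℝ (⊤ : ℕ∞) (pθ F t) :=
  (contDiff_infty_iff_deriv.1 hF).2

lemma pθ_periodic {F : ℝ → ℝ → ℝ} (hF : ∀ t θ, F t (θ + 1) = F t θ) (t θ : ℝ) :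
    pθ F t (θ + 1) = pθ F t θ := by
  unfold pθ
  rw [← deriv_comp_add_const]
  simp_rw [hF]

/-- The energy is bounded towards the past: it is nonincreasing in time, but decays at most like
`t⁻⁴`. -/
lemma exists_bound_Etilde (htp : 0 < tp) (hti : tp < ti)
    (hν : ContDiffOn ℝ (⊤ : ℕ∞) (fun p : ℝ × ℝ => ν p.1 p.2) (Ioo tp ti ×ˢ univ))
    (hα : ContDiffOn ℝ (⊤ : ℕ∞) (fun p : ℝ × ℝ => α p.1 p.2) (Ioo tp ti ×ˢ univ))
    (hνper : ∀ t θ, ν t (θ + 1) = ν t θ) (hαper : ∀ t θ, α t (θ + 1) = α t θ)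
    (hαpos : ∀ t ∈ Ioo tp ti, ∀ θ, 0 < α t θ)
    (hnut0 : ∀ t ∈ Ioo tp ti, ∀ θ, 0 ≤ pt ν t θ)
    (hXle : ∀ t ∈ Ioo tp ti, ∀ θ, X t θ ≤ pt ν t θ / t)
    (hXge : ∀ t ∈ Ioo tp ti, ∀ θ, -(3 * pt ν t θ / t) ≤ X t θ)
    (hnutt : ∀ t ∈ Ioo tp ti, ∀ θ, pt (pt ν) t θ = α t θ * pθ (pθ ν) t θ
      + pt α t θ * pt ν t θ / (2 * α t θ) + pθ α t θ * pθ ν t θ / 2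
      + pθ (pθ α) t θ / 2 - pθ α t θ ^ 2 / (4 * α t θ) + X t θ) :
    ∃ B, ∀ t ∈ Ioo tp ti, Etilde ν α t ≤ B := by
  have hpos : ∀ t ∈ Ioo tp ti, 0 < t := fun t ht => htp.trans ht.1
  have hnut : ContDiffOn ℝ (⊤ : ℕ∞) (fun p : ℝ × ℝ => pt ν p.1 p.2) (Ioo tp ti ×ˢ univ) :=
    contDiffOn_deriv_fst hν
  set e : ℝ × ℝ → ℝ := fun p => pt ν p.1 p.2 / (√(α p.1 p.2) * p.1) with he_def
  have he : ContDiffOn ℝ (⊤ : ℕ∞) e (Ioo tp ti ×ˢ univ) := by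
    refine hnut.div ((hα.sqrt fun p hp => (hαpos _ hp.1 _).ne').mul contDiffOn_fst) fun p hp => ?_
    have := hαpos _ hp.1 p.2
    have := hpos _ hp.1
    positivity
  have hE : ∀ t, Etilde ν α t = ∫ θ in Icc (0 : ℝ) 1, e (t, θ) := fun t => by
    rw [Etilde, intervalIntegral.integral_of_le zero_le_one, integral_Icc_eq_integral_Ioc]
  have hint : ∀ {g : ℝ → ℝ}, Continuous g → IntegrableOn g (Icc 0 1) := fun hg =>
    hg.continuousOn.integrableOn_compact isCompact_Icc
  have hrate : ∀ t ∈ Ioo tp ti, ∃ r : ℝ → ℝ, Continuous r ∧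
      (∀ θ, r θ ≤ 0) ∧ (∀ θ, -(4 / t * e (t, θ)) ≤ r θ) ∧
      ∫ θ in Icc (0 : ℝ) 1, deriv (fun s => e (s, θ)) t = ∫ θ in Icc (0 : ℝ) 1, r θ := by
    intro t ht
    have ht0 := hpos t ht
    have hs : ∀ θ, 0 < √(α t θ) := fun θ => Real.sqrt_pos.2 (hαpos t ht θ)
    have hνt : ContDiff ℝ (⊤ : ℕ∞) (ν t) := hν.slice_right ht
    have hαt : ContDiff ℝ (⊤ : ℕ∞) (α t) := hα.slice_right ht
    have hsq : ContDiff ℝ (⊤ : ℕ∞) fun θ => √(α t θ) := hαt.sqrt fun θ => (hαpos t ht θ).ne'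
    set S : ℝ → ℝ := fun θ => √(α t θ) * pθ ν t θ + pθ α t θ / (2 * √(α t θ)) with hS_def
    have hS : ContDiff ℝ (⊤ : ℕ∞) S :=
      (hsq.mul (contDiff_pθ hνt)).add ((contDiff_pθ hαt).div (contDiff_const.mul hsq)
        fun θ => (mul_pos two_pos (hs θ)).ne')
    have hSc : Continuous (deriv S) := hS.continuous_deriv (by simp)
    have hS0 : ∫ θ in Icc (0 : ℝ) 1, deriv S θ = 0 := by
      rw [integral_Icc_eq_integral_Ioc, ← intervalIntegral.integral_of_le zero_le_one,
        intervalIntegral.integral_deriv_eq_sub' (f := S) rfl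
          (fun z _ => hS.differentiable (by simp) z) hSc.continuousOn, sub_eq_zero, hS_def]
      have h1 := hαper t 0
      have h2 := pθ_periodic hαper t 0
      have h3 := pθ_periodic hνper t 0
      rw [zero_add] at h1 h2 h3
      simp only [h1, h2, h3]
    have hec : Continuous fun θ => deriv (fun s => e (s, θ)) t :=
      ((contDiffOn_deriv_fst he).slice_right ht).continuous
    have hkey : ∀ θ, deriv (fun s => e (s, θ)) t - deriv S θ / t
        = (X t θ - pt ν t θ / t) / (√(α t θ) * t) := by
      intro θ
      have hα0 := hαpos t ht θ
      have d1 : HasDerivAt (fun s => pt ν s θ) (pt (pt ν) t θ) t :=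
        (hasDerivAt_fst_of_contDiffOn hnut ht θ).differentiableAt.hasDerivAt
      have d2 : HasDerivAt (fun s => α s θ) (pt α t θ) t :=
        (hasDerivAt_fst_of_contDiffOn hα ht θ).differentiableAt.hasDerivAt
      have d3 : HasDerivAt (pθ ν t) (pθ (pθ ν) t θ) θ :=
        ((contDiff_pθ hνt).differentiable (by simp) θ).hasDerivAt
      have d4 : HasDerivAt (pθ α t) (pθ (pθ α) t θ) θ :=
        ((contDiff_pθ hαt).differentiable (by simp) θ).hasDerivAt
      have d5 : HasDerivAt (α t) (pθ α t θ) θ := (hαt.differentiable (by simp) θ).hasDerivAt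
      have d6 := d1.div ((d2.sqrt hα0.ne').mul (hasDerivAt_id t)) (mul_pos (hs θ) ht0).ne'
      have d7 := ((d5.sqrt hα0.ne').mul d3).add
        (d4.div ((d5.sqrt hα0.ne').const_mul 2) (mul_pos two_pos (hs θ)).ne')
      have d6' : deriv (fun s => e (s, θ)) t = _ := d6.deriv
      have d7' : deriv S θ = _ := d7.deriv
      rw [d6', d7']
      simp only [Pi.mul_apply, id, mul_one]
      refine deriv_energy_density_sub_divergence (hs θ) ht0 ?_
      rw [Real.sq_sqrt hα0.le]
      exact hnutt t ht θ
    refine ⟨fun θ => deriv (fun s => e (s, θ)) t - deriv S θ / t, hec.sub (hSc.div_const t),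
      fun θ => ?_, fun θ => ?_, ?_⟩
    · simp only [hkey]
      exact div_nonpos_of_nonpos_of_nonneg (sub_nonpos.2 (hXle t ht θ)) (mul_pos (hs θ) ht0).le
    · simp only [hkey]
      have : -(4 / t * e (t, θ)) = (-(3 * pt ν t θ / t) - pt ν t θ / t) / (√(α t θ) * t) := by
        have := hs θ
        simp only [he_def]
        field_simp
        ring
      rw [this]
      have := hXge t ht θ
      have := (mul_pos (hs θ) ht0).le
      gcongr
    · rw [integral_sub (hint hec) (hint (hSc.div_const t)), integral_div, hS0, zero_div, sub_zero]
  simp_rw [hE]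
  refine bounded_of_logarithmic_decay htp hti
    (fun t ht => hasDerivAt_setIntegral_of_contDiffOn he isCompact_Icc ht) ?_ ?_ ?_
  · refine fun t ht => integral_nonneg fun θ => div_nonneg (hnut0 t ht θ) ?_
    exact mul_nonneg (Real.sqrt_nonneg _) (hpos t ht).le
  · intro t ht
    obtain ⟨r, -, h0, -, h⟩ := hrate t ht
    rw [h]
    exact integral_nonpos h0
  · intro t ht
    obtain ⟨r, hr, -, h1, h⟩ := hrate t ht
    rw [h, mul_div_right_comm, ← integral_const_mul, ← integral_neg]
    exact setIntegral_mono (hint (continuous_const.mul (he.slice_right ht).continuous)).neg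
      (hint hr) h1

end Energy

section Pointwise

variable {s t N a b c d x j k M : ℝ}

lemma abs_gradient_le (hs : 0 < s) (ht : 0 < t) (hj : 0 ≤ j) (hk : 0 ≤ k) {P : ℝ} (hP : |P| ≤ M)
    (hN : N = t * (a ^ 2 + s ^ 2 * b ^ 2 + x ^ 2 / (4 * t ^ 2) * (c ^ 2 + s ^ 2 * d ^ 2)) + j + k
      + s * M) :
    |2 * t * (a * b + x ^ 2 / (4 * t ^ 2) * c * d) - P| ≤ t * (N / (s * t)) := by
  have e : t * (N / (s * t)) = N / s := by field_simp
  have hx : 0 ≤ x ^ 2 / (4 * t ^ 2) := by positivity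
  obtain ⟨h1, h2⟩ := abs_le.1 hP
  have h1' := mul_le_mul_of_nonneg_left h1 hs.le
  have h2' := mul_le_mul_of_nonneg_left h2 hs.le
  have i1 := mul_nonneg ht.le (sq_nonneg (a + s * b))
  have i2 := mul_nonneg ht.le (sq_nonneg (a - s * b))
  have i3 := mul_nonneg ht.le (mul_nonneg hx (sq_nonneg (c + s * d)))
  have i4 := mul_nonneg ht.le (mul_nonneg hx (sq_nonneg (c - s * d)))
  rw [e, abs_le, ← neg_div, div_le_iff₀ hs, le_div_iff₀ hs, hN]
  constructor <;> nlinarith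

lemma two_mul_abs_le (hs : 0 < s) {y e : ℝ} (h : s * y ^ 2 ≤ e) : 2 * |y| ≤ e + 1 / s := by
  have h1 : 0 ≤ (s * |y| - 1) ^ 2 / s := by positivity
  have h2 : (s * |y| - 1) ^ 2 / s = s * y ^ 2 - 2 * |y| + 1 / s := by
    rw [← sq_abs y]
    field_simp
    ring
  linarith

lemma density_ge (hs : 0 < s) (ht : 0 < t) (hj : 0 ≤ j) (hk : 0 ≤ k) (hM : 0 ≤ M)
    (hN : N = t * (a ^ 2 + s ^ 2 * b ^ 2 + x ^ 2 / (4 * t ^ 2) * (c ^ 2 + s ^ 2 * d ^ 2)) + j + k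
      + s * M) :
    s * b ^ 2 + s * (x * d) ^ 2 / (4 * t ^ 2) ≤ N / (s * t) := by
  have hsM := mul_nonneg hs.le hM
  have h : 0 ≤ t * (a ^ 2 + x ^ 2 / (4 * t ^ 2) * c ^ 2) := by positivity
  rw [le_div_iff₀ (by positivity), hN]
  have : (s * b ^ 2 + s * (x * d) ^ 2 / (4 * t ^ 2)) * (s * t)
      = t * (s ^ 2 * b ^ 2 + x ^ 2 / (4 * t ^ 2) * (s ^ 2 * d ^ 2)) := by ring
  nlinarith

lemma source_bounds (hs : 0 < s) (ht : 0 < t) (hj : 0 ≤ j) (hk : 0 ≤ k) {Q : ℝ} (hQ : 0 ≤ Q)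
    (hQM : Q ≤ s * M / t)
    (hN : N = t * (a ^ 2 + s ^ 2 * b ^ 2 + x ^ 2 / (4 * t ^ 2) * (c ^ 2 + s ^ 2 * d ^ 2)) + j + k
      + s * M) :
    -a ^ 2 + s ^ 2 * b ^ 2 + x ^ 2 / (4 * t ^ 2) * (c ^ 2 - s ^ 2 * d ^ 2) - j / t - 3 * k / t - Q
        ≤ N / t ∧
      -(3 * N / t) ≤ -a ^ 2 + s ^ 2 * b ^ 2 + x ^ 2 / (4 * t ^ 2) * (c ^ 2 - s ^ 2 * d ^ 2)
        - j / t - 3 * k / t - Q := by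
  have e : N / t = a ^ 2 + s ^ 2 * b ^ 2
      + (x ^ 2 / (4 * t ^ 2) * c ^ 2 + x ^ 2 / (4 * t ^ 2) * (s ^ 2 * d ^ 2)) + j / t + k / t
      + s * M / t := by
    rw [hN]
    field_simp
  have h1 : 0 ≤ j / t := by positivity
  have h2 : 0 ≤ k / t := by positivity
  have h3 : 0 ≤ x ^ 2 / (4 * t ^ 2) * c ^ 2 := by positivity
  have h4 : 0 ≤ x ^ 2 / (4 * t ^ 2) * (s ^ 2 * d ^ 2) := by positivity
  have h5 : 0 ≤ s ^ 2 * b ^ 2 := by positivity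
  have h6 := sq_nonneg a
  rw [mul_sub, mul_div_assoc, mul_div_assoc, e]
  constructor <;> linarith

end Pointwise

lemma integral_le_affine {g e : ℝ → ℝ} (hg : Continuous g) (he : Continuous e) {p q : ℝ}
    (h : ∀ θ, g θ ≤ p * e θ + q) :
    ∫ θ in (0 : ℝ)..1, g θ ≤ p * (∫ θ in (0 : ℝ)..1, e θ) + q := by
  have h1 : ∫ θ in (0 : ℝ)..1, (p * e θ + q) = p * (∫ θ in (0 : ℝ)..1, e θ) + q := by
    rw [intervalIntegral.integral_add ((he.const_mul p).intervalIntegrable _ _)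
      (by simp), intervalIntegral.integral_const_mul]
    simp
  rw [← h1]
  exact intervalIntegral.integral_mono_on zero_le_one (hg.intervalIntegrable _ _)
    (((he.const_mul p).add continuous_const).intervalIntegrable _ _) fun θ _ => h θ

lemma exists_bound_Ioc {a b : ℝ} {q : ℝ → ℝ} (h : ∃ B, ∀ t ∈ Ioo a b, q t ≤ B) :
    ∃ B, ∀ t ∈ Ioc a b, q t ≤ B := by
  obtain ⟨B, hB⟩ := h
  refine ⟨max B (q b), fun t ht => ?_⟩
  rcases ht.2.eq_or_lt with rfl | hlt
  · exact le_max_right _ _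
  · exact (hB t ⟨ht.1, hlt⟩).trans (le_max_left _ _)

lemma integral_abs_current_le {F : ℝ → V3 → ℝ} (hF : Continuous fun p : ℝ × V3 => F p.1 p.2)
    (hF0 : ∀ θ v, 0 ≤ F θ v) (hsupp : ∃ R : ℝ, ∀ θ v, R < ‖v‖ → F θ v = 0)
    {w : ℝ × ℝ → ℝ} (hw : Continuous w) {h : ℝ → ℝ} (hh : Continuous h)
    (heq : ∀ θ, h θ = 2 * ∫ v, F θ v * w v.2) :
    ∫ θ in (0 : ℝ)..1, |h θ| ≤ 2 * ∫ θ in Icc (0 : ℝ) 1, ∫ v, F θ v * |w v.2| := by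
  have hint : Integrable (fun p : ℝ × V3 => F p.1 p.2 * |w p.2.2|)
      ((volume.restrict (Icc (0 : ℝ) 1)).prod volume) := by
    refine integrable_cylinder (by fun_prop) ?_
    obtain ⟨R, hR⟩ := hsupp
    exact ⟨R, fun θ v hv => by simp [hR θ v hv]⟩
  rw [intervalIntegral.integral_of_le zero_le_one, ← integral_Icc_eq_integral_Ioc,
    ← integral_const_mul]
  refine integral_mono (hh.abs.continuousOn.integrableOn_compact isCompact_Icc)
    (hint.integral_prod_left.const_mul 2) fun θ => ?_
  simp only [heq, abs_mul, abs_two]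
  have h1 := norm_integral_le_integral_norm (μ := volume) fun v : V3 => F θ v * w v.2
  simp only [Real.norm_eq_abs, abs_mul, abs_of_nonneg (hF0 θ _)] at h1
  exact mul_le_mul_of_nonneg_left h1 two_pos.le

lemma exists_pos_le_of_pt_nonpos {tp ti : ℝ} {α : ℝ → ℝ → ℝ} (hti : tp < ti)
    (hα : ContDiffOn ℝ (⊤ : ℕ∞) (fun p : ℝ × ℝ => α p.1 p.2) (Ioc tp ti ×ˢ (univ : Set ℝ)))
    (hαpos : ∀ θ, 0 < α ti θ) (hαper : ∀ t θ, α t (θ + 1) = α t θ)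
    (hαt : ∀ t ∈ Ioo tp ti, ∀ θ, pt α t θ ≤ 0) :
    ∃ c > 0, ∀ t ∈ Ioc tp ti, ∀ θ, c ≤ α t θ := by
  have hmem : ti ∈ Ioc tp ti := ⟨hti, le_rfl⟩
  have hc : Continuous (α ti) := (hα.slice_right hmem).continuous
  obtain ⟨θ₀, -, hθ₀⟩ := isCompact_Icc.exists_isMinOn (nonempty_Icc.2 (zero_le_one (α := ℝ)))
    hc.continuousOn
  have hper : Function.Periodic (α ti) 1 := hαper ti
  refine ⟨α ti θ₀, hαpos θ₀, fun t ht θ => ?_⟩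
  have hanti : AntitoneOn (fun s => α s θ) (Ioc tp ti) := by
    have hcs : ContDiffOn ℝ (⊤ : ℕ∞) (fun s => α s θ) (Ioc tp ti) :=
      hα.comp (contDiff_id.prodMk contDiff_const).contDiffOn fun s hs => ⟨hs, mem_univ _⟩
    refine antitoneOn_of_deriv_nonpos (convex_Ioc tp ti) hcs.continuousOn ?_ ?_ <;>
      rw [interior_Ioc]
    · exact (hcs.differentiableOn (by simp)).mono Ioo_subset_Ioc_self
    · exact fun s hs => hαt s hs θ
  obtain ⟨y, hy, hyθ⟩ := hper.exists_mem_Ico₀ one_pos θ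
  calc α ti θ₀ ≤ α ti y := hθ₀ ⟨hy.1, hy.2.le⟩
    _ = α ti θ := hyθ.symm
    _ ≤ α t θ := hanti ht hmem ht.2

theorem oscillation_bounds
    (tp ti : ℝ) (htp : 0 < tp) (hti : tp < ti)
    (U A ν α J K : ℝ → ℝ → ℝ) (f : ℝ → ℝ → V3 → ℝ)
    (vb2 vb3 : ℝ) (hv2 : 0 < vb2) (hv3 : 0 < vb3)
    (hsuppv : ∀ (θ : ℝ) (v : V3), vb2 < |v.2.1| ∨ vb3 < |v.2.2| → f ti θ v = 0)
    (hUsm : ContDiffOn ℝ (⊤ : ℕ∞) (fun p : ℝ × ℝ => U p.1 p.2) (Ioc tp ti ×ˢ (univ : Set ℝ)))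
    (hAsm : ContDiffOn ℝ (⊤ : ℕ∞) (fun p : ℝ × ℝ => A p.1 p.2) (Ioc tp ti ×ˢ (univ : Set ℝ)))
    (hνsm : ContDiffOn ℝ (⊤ : ℕ∞) (fun p : ℝ × ℝ => ν p.1 p.2) (Ioc tp ti ×ˢ (univ : Set ℝ)))
    (hαsm : ContDiffOn ℝ (⊤ : ℕ∞) (fun p : ℝ × ℝ => α p.1 p.2) (Ioc tp ti ×ˢ (univ : Set ℝ)))
    (hJsm : ContDiffOn ℝ (⊤ : ℕ∞) (fun p : ℝ × ℝ => J p.1 p.2) (Ioc tp ti ×ˢ (univ : Set ℝ)))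
    (hKsm : ContDiffOn ℝ (⊤ : ℕ∞) (fun p : ℝ × ℝ => K p.1 p.2) (Ioc tp ti ×ˢ (univ : Set ℝ)))
    (hfsm : ContDiffOn ℝ (⊤ : ℕ∞) (fun p : ℝ × ℝ × V3 => f p.1 p.2.1 p.2.2) (Ioc tp ti ×ˢ (univ : Set (ℝ × V3))))
    (hUper : ∀ t θ, U t (θ + 1) = U t θ)
    (hAper : ∀ t θ, A t (θ + 1) = A t θ)
    (hνper : ∀ t θ, ν t (θ + 1) = ν t θ)
    (hαper : ∀ t θ, α t (θ + 1) = α t θ)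
    (hJper : ∀ t θ, J t (θ + 1) = J t θ)
    (hKper : ∀ t θ, K t (θ + 1) = K t θ)
    (hfper : ∀ t θ v, f t (θ + 1) v = f t θ v)
    (hαpos : ∀ t ∈ Ioc tp ti, ∀ θ : ℝ, 0 < α t θ)
    (hfnn : ∀ t ∈ Ioc tp ti, ∀ (θ : ℝ) (v : V3), 0 ≤ f t θ v)
    (hfsupp : ∀ t ∈ Ioc tp ti, ∃ R : ℝ, ∀ (θ : ℝ) (v : V3), R < ‖v‖ → f t θ v = 0)
    (hvlasov :
      ∀ t ∈ Ioc tp ti, ∀ (θ : ℝ) (v : V3),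
      ptf f t θ v
        = pv1 (v0 α ν U A t θ) v * pθf f t θ v
          - (deriv (fun x => v0 α ν U A t x v) θ
              + Real.sqrt (α t θ) * Real.exp (2 * ν t θ) / t ^ 3 * (K t θ - A t θ * J t θ) * (v.2.2 - A t θ * v.2.1)
              + Real.sqrt (α t θ) * Real.exp (2 * ν t θ - 4 * U t θ) / t * J t θ * v.2.1)
            * pv1 (f t θ) v)
    (hnut :
      ∀ t ∈ Ioc tp ti, ∀ θ : ℝ,
      (pt ν t θ)
        = t * ((pt U t θ) ^ 2 + α t θ * (pθ U t θ) ^ 2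
              + Real.exp (4 * U t θ) / (4 * t ^ 2) * ((pt A t θ) ^ 2 + α t θ * (pθ A t θ) ^ 2))
          + α t θ * Real.exp (2 * ν t θ - 4 * U t θ) / (4 * t) * J t θ ^ 2
          + α t θ * Real.exp (2 * ν t θ) / (4 * t ^ 3) * (K t θ - A t θ * J t θ) ^ 2
          + Real.sqrt (α t θ) * ∫ v : V3, f t θ v * |v0 α ν U A t θ v|)
    (hnuth :
      ∀ t ∈ Ioc tp ti, ∀ θ : ℝ,
      (pθ ν t θ)
        = 2 * t * ((pt U t θ) * (pθ U t θ) + Real.exp (4 * U t θ) / (4 * t ^ 2) * (pt A t θ) * (pθ A t θ))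
          - (pθ α t θ) / (2 * α t θ)
          - Real.sqrt (α t θ) * ∫ v : V3, f t θ v * v.1)
    (halt :
      ∀ t ∈ Ioc tp ti, ∀ θ : ℝ,
      (pt α t θ) / α t θ
        = - (α t θ * Real.exp (2 * ν t θ - 4 * U t θ) * J t θ ^ 2 / t)
          - α t θ * Real.exp (2 * ν t θ) * (K t θ - A t θ * J t θ) ^ 2 / t ^ 3
          - 2 * (α t θ * Real.sqrt (α t θ)) * Real.exp (2 * ν t θ)
            * ∫ v : V3, f t θ v
                * (Real.exp (-2 * U t θ) + Real.exp (-4 * U t θ) * v.2.1 ^ 2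
                    + (t ^ 2)⁻¹ * (v.2.2 - A t θ * v.2.1) ^ 2)
                / |v0 α ν U A t θ v|)
    (hjth :
      ∀ t ∈ Ioc tp ti, ∀ θ : ℝ,
      (pθ J t θ) = 2 * ∫ v : V3, f t θ v * v.2.1)
    (hkth :
      ∀ t ∈ Ioc tp ti, ∀ θ : ℝ,
      (pθ K t θ) = 2 * ∫ v : V3, f t θ v * v.2.2)
    (hnutt :
      ∀ t ∈ Ioc tp ti, ∀ θ : ℝ,
      (pt (pt ν) t θ)
        = α t θ * (pθ (pθ ν) t θ)
          + (pt α t θ) * (pt ν t θ) / (2 * α t θ) + (pθ α t θ) * (pθ ν t θ) / 2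
          + (pθ (pθ α) t θ) / 2 - (pθ α t θ) ^ 2 / (4 * α t θ)
          - (pt U t θ) ^ 2 + α t θ * (pθ U t θ) ^ 2
          + Real.exp (4 * U t θ) / (4 * t ^ 2) * ((pt A t θ) ^ 2 - α t θ * (pθ A t θ) ^ 2)
          - α t θ * Real.exp (2 * ν t θ - 4 * U t θ) * J t θ ^ 2 / (4 * t ^ 2)
          - 3 * α t θ * Real.exp (2 * ν t θ) * (K t θ - A t θ * J t θ) ^ 2 / (4 * t ^ 4)
          - (α t θ * Real.sqrt (α t θ)) * Real.exp (2 * ν t θ) / t ^ 3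
            * ∫ v : V3, f t θ v * (v.2.2 - A t θ * v.2.1) ^ 2 / |v0 α ν U A t θ v|)
    (hC2 : 0 < ∫ θ in (0:ℝ)..1, ∫ v : V3, f ti θ v) :
    ∃ C₄ : ℝ, 0 < C₄ ∧ ∀ t ∈ Ioc tp ti,
      (∫ θ in (0:ℝ)..1, |pθ (betaF ν α) t θ|) < C₄
      ∧ (∫ θ in (0:ℝ)..1, |pθ U t θ|) < C₄
      ∧ (∫ θ in (0:ℝ)..1, Real.exp (2 * U t θ) * |pθ A t θ|) < C₄
      ∧ (∫ θ in (0:ℝ)..1, |pθ J t θ|) < C₄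
      ∧ (∫ θ in (0:ℝ)..1, |pθ K t θ|) < C₄
      ∧ ∀ θ₁ ∈ Icc (0:ℝ) 1, ∀ θ₂ ∈ Icc (0:ℝ) 1,
          betaF ν α t θ₁ - betaF ν α t θ₂ < C₄
          ∧ U t θ₁ - U t θ₂ < C₄
          ∧ J t θ₁ - J t θ₂ < C₄
          ∧ K t θ₁ - K t θ₂ < C₄ := by
  have hsub : Ioo tp ti ⊆ Ioc tp ti := Ioo_subset_Ioc_self
  have hmono : Ioo tp ti ×ˢ (univ : Set ℝ) ⊆ Ioc tp ti ×ˢ univ := prod_mono hsub subset_rfl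
  have hmem : ti ∈ Ioc tp ti := ⟨hti, le_rfl⟩
  have hpos : ∀ t ∈ Ioc tp ti, 0 < t := fun t ht => htp.trans ht.1
  have hsq : ∀ t ∈ Ioc tp ti, ∀ θ, √(α t θ) ^ 2 = α t θ := fun t ht θ =>
    Real.sq_sqrt (hαpos t ht θ).le
  have hexp : ∀ t θ, Real.exp (2 * U t θ) ^ 2 = Real.exp (4 * U t θ) := fun t θ => by
    rw [← Real.exp_nat_mul]
    ring_nf
  have hfc : ∀ t ∈ Ioc tp ti, Continuous fun p : ℝ × V3 => f t p.1 p.2 := fun t ht =>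
    (hfsm.slice_right ht).continuous
  have hfc' : ∀ t ∈ Ioc tp ti, ∀ θ, Continuous (f t θ) := fun t ht θ =>
    (hfc t ht).comp (Continuous.prodMk_right θ)
  have hfsupp' : ∀ t ∈ Ioc tp ti, ∀ θ, ∃ R : ℝ, ∀ v, R < ‖v‖ → f t θ v = 0 := fun t ht θ =>
    (hfsupp t ht).imp fun R hR => hR θ
  have hU : ∀ t ∈ Ioc tp ti, ContDiff ℝ (⊤ : ℕ∞) (U t) := fun t ht => hUsm.slice_right ht
  have hA : ∀ t ∈ Ioc tp ti, ContDiff ℝ (⊤ : ℕ∞) (A t) := fun t ht => hAsm.slice_right ht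
  have hJ : ∀ t ∈ Ioc tp ti, ContDiff ℝ (⊤ : ℕ∞) (J t) := fun t ht => hJsm.slice_right ht
  have hK : ∀ t ∈ Ioc tp ti, ContDiff ℝ (⊤ : ℕ∞) (K t) := fun t ht => hKsm.slice_right ht
  have hβ : ∀ t ∈ Ioc tp ti, ContDiff ℝ (⊤ : ℕ∞) (betaF ν α t) := fun t ht =>
    (hνsm.slice_right ht).add
      (((hαsm.slice_right ht).log fun θ => (hαpos t ht θ).ne').div_const 2)
  set M : ℝ → ℝ → ℝ := fun t θ => ∫ v, f t θ v * |v0 α ν U A t θ v| with hM_def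
  have hM : ∀ t ∈ Ioc tp ti, ∀ θ, 0 ≤ M t θ := fun t ht θ =>
    integral_nonneg fun v => mul_nonneg (hfnn t ht θ v) (abs_nonneg _)
  set j : ℝ → ℝ → ℝ := fun t θ => α t θ * Real.exp (2 * ν t θ - 4 * U t θ) / (4 * t) * J t θ ^ 2
    with hj_def
  set k : ℝ → ℝ → ℝ := fun t θ =>
    α t θ * Real.exp (2 * ν t θ) / (4 * t ^ 3) * (K t θ - A t θ * J t θ) ^ 2 with hk_def
  have hj : ∀ t ∈ Ioc tp ti, ∀ θ, 0 ≤ j t θ := fun t ht θ => by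
    have := hpos t ht
    have := hαpos t ht θ
    positivity
  have hk : ∀ t ∈ Ioc tp ti, ∀ θ, 0 ≤ k t θ := fun t ht θ => by
    have := hpos t ht
    have := hαpos t ht θ
    positivity
  have hN : ∀ t ∈ Ioc tp ti, ∀ θ, pt ν t θ
      = t * (pt U t θ ^ 2 + √(α t θ) ^ 2 * pθ U t θ ^ 2 + Real.exp (2 * U t θ) ^ 2 / (4 * t ^ 2)
        * (pt A t θ ^ 2 + √(α t θ) ^ 2 * pθ A t θ ^ 2)) + j t θ + k t θ + √(α t θ) * M t θ :=
    fun t ht θ => by rw [hnut t ht θ, hsq t ht, hexp]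
  obtain ⟨c, hc, hcα⟩ : ∃ c > 0, ∀ t ∈ Ioc tp ti, ∀ θ, c ≤ α t θ := by
    refine exists_pos_le_of_pt_nonpos hti hαsm (hαpos ti hmem) hαper fun t ht θ => ?_
    have ht := hsub ht
    have ht0 := hpos t ht
    have hα0 := hαpos t ht θ
    have h1 : 0 ≤ ∫ v : V3, f t θ v * (Real.exp (-2 * U t θ) + Real.exp (-4 * U t θ) * v.2.1 ^ 2
        + (t ^ 2)⁻¹ * (v.2.2 - A t θ * v.2.1) ^ 2) / |v0 α ν U A t θ v| :=
      integral_nonneg fun v => by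
        have := hfnn t ht θ v
        simp only [Pi.zero_apply]
        positivity
    have h2 : 0 ≤ α t θ * Real.exp (2 * ν t θ - 4 * U t θ) * J t θ ^ 2 / t := by positivity
    have h3 : 0 ≤ α t θ * Real.exp (2 * ν t θ) * (K t θ - A t θ * J t θ) ^ 2 / t ^ 3 := by
      positivity
    have h4 := mul_nonneg
      (by positivity : 0 ≤ 2 * (α t θ * √(α t θ)) * Real.exp (2 * ν t θ)) h1
    have h5 : pt α t θ / α t θ ≤ 0 := by
      rw [halt t ht θ]
      linarith
    simpa using (div_le_iff₀ hα0).1 h5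
  set X : ℝ → ℝ → ℝ := fun t θ => -pt U t θ ^ 2 + α t θ * pθ U t θ ^ 2
      + Real.exp (4 * U t θ) / (4 * t ^ 2) * (pt A t θ ^ 2 - α t θ * pθ A t θ ^ 2)
      - α t θ * Real.exp (2 * ν t θ - 4 * U t θ) * J t θ ^ 2 / (4 * t ^ 2)
      - 3 * α t θ * Real.exp (2 * ν t θ) * (K t θ - A t θ * J t θ) ^ 2 / (4 * t ^ 4)
      - (α t θ * √(α t θ)) * Real.exp (2 * ν t θ) / t ^ 3
        * ∫ v : V3, f t θ v * (v.2.2 - A t θ * v.2.1) ^ 2 / |v0 α ν U A t θ v| with hX_def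
  have hX : ∀ t ∈ Ioc tp ti, ∀ θ, X t θ ≤ pt ν t θ / t ∧ -(3 * pt ν t θ / t) ≤ X t θ := by
    intro t ht θ
    have ht0 := hpos t ht
    have hα0 := hαpos t ht θ
    have hp := pressure_le (t := t) (ν := ν) (U := U) (A := A) hα0 (hfc' t ht θ) (hfnn t ht θ)
      (hfsupp' t ht θ)
    set P := ∫ v : V3, f t θ v * (v.2.2 - A t θ * v.2.1) ^ 2 / |v0 α ν U A t θ v|
    have hP : 0 ≤ P := integral_nonneg fun v => by
      have := hfnn t ht θ v
      simp only [Pi.zero_apply]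
      positivity
    have hQ : 0 ≤ (α t θ * √(α t θ)) * Real.exp (2 * ν t θ) / t ^ 3 * P := by positivity
    have hQM : (α t θ * √(α t θ)) * Real.exp (2 * ν t θ) / t ^ 3 * P ≤ √(α t θ) * M t θ / t := by
      have h1 := mul_le_mul_of_nonneg_left hp (by positivity : 0 ≤ √(α t θ) / t)
      calc _ = √(α t θ) / t * (α t θ * (t ^ 2)⁻¹ * Real.exp (2 * ν t θ) * P) := by field_simp
        _ ≤ _ := h1
        _ = _ := by rw [div_mul_eq_mul_div]
    have h := source_bounds (Real.sqrt_pos.2 hα0) ht0 (hj t ht θ) (hk t ht θ) hQ hQM (hN t ht θ)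
    rw [hsq t ht, hexp] at h
    have e1 : j t θ / t = α t θ * Real.exp (2 * ν t θ - 4 * U t θ) * J t θ ^ 2 / (4 * t ^ 2) := by
      simp only [hj_def]
      field_simp
    have e2 : 3 * k t θ / t
        = 3 * α t θ * Real.exp (2 * ν t θ) * (K t θ - A t θ * J t θ) ^ 2 / (4 * t ^ 4) := by
      simp only [hk_def]
      field_simp
    rwa [e1, e2] at h
  have hnut0 : ∀ t ∈ Ioc tp ti, ∀ θ, 0 ≤ pt ν t θ := fun t ht θ => by
    have := hpos t ht
    have := hM t ht θ
    have := hj t ht θ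
    have := hk t ht θ
    rw [hN t ht θ]
    positivity
  obtain ⟨B, hB⟩ : ∃ B, ∀ t ∈ Ioo tp ti, Etilde ν α t ≤ B := by
    refine exists_bound_Etilde (X := X) htp hti (hνsm.mono hmono) (hαsm.mono hmono) hνper hαper
      (fun t ht => hαpos t (hsub ht)) (fun t ht => hnut0 t (hsub ht))
      (fun t ht θ => (hX t (hsub ht) θ).1) (fun t ht θ => (hX t (hsub ht) θ).2) fun t ht θ => ?_
    rw [hnutt t (hsub ht) θ]
    simp only [hX_def]
    ring
  set e : ℝ → ℝ → ℝ := fun t θ => pt ν t θ / (√(α t θ) * t) with he_def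
  have hec : ∀ t ∈ Ioo tp ti, Continuous (e t) := fun t ht => by
    have h1 : Continuous (pt ν t) :=
      ((contDiffOn_deriv_fst (hνsm.mono hmono)).slice_right ht).continuous
    have h2 : Continuous (α t) := (hαsm.slice_right (hsub ht)).continuous
    refine h1.div (h2.sqrt.mul continuous_const) fun θ => ?_
    exact (mul_pos (Real.sqrt_pos.2 (hαpos t (hsub ht) θ)) (hpos t (hsub ht))).ne'
  have he0 : ∀ t ∈ Ioc tp ti, ∀ θ, 0 ≤ e t θ := fun t ht θ =>
    div_nonneg (hnut0 t ht θ) (mul_nonneg (Real.sqrt_nonneg _) (hpos t ht).le)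
  have hfield : ∀ t ∈ Ioc tp ti, ∀ θ,
      √(α t θ) * pθ U t θ ^ 2 + √(α t θ) * (Real.exp (2 * U t θ) * pθ A t θ) ^ 2 / (4 * t ^ 2)
        ≤ e t θ := fun t ht θ =>
    density_ge (Real.sqrt_pos.2 (hαpos t ht θ)) (hpos t ht) (hj t ht θ) (hk t ht θ) (hM t ht θ)
      (hN t ht θ)
  have hD : ∀ t ∈ Ioc tp ti, ∀ θ, 1 / √(α t θ) ≤ 1 / √c := fun t ht θ =>
    one_div_le_one_div_of_le (Real.sqrt_pos.2 hc) (Real.sqrt_le_sqrt (hcα t ht θ))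
  obtain ⟨B₁, hB₁⟩ : ∃ B, ∀ t ∈ Ioc tp ti, ∫ θ in (0 : ℝ)..1, |pθ (betaF ν α) t θ| ≤ B := by
    refine exists_bound_Ioc ⟨ti * B, fun t ht' => ?_⟩
    have ht := hsub ht'
    have h := integral_le_affine (contDiff_pθ (hβ t ht)).continuous.abs (hec t ht') (p := ti)
      (q := 0) fun θ => ?_
    · have := mul_le_mul_of_nonneg_left (hB t ht') (htp.trans hti).le
      exact (h.trans_eq (add_zero _)).trans this
    · have hα0 := hαpos t ht θ
      have d : HasDerivAt (betaF ν α t) (pθ ν t θ + pθ α t θ / α t θ / 2) θ :=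
        (((hνsm.slice_right ht).differentiable (by simp) θ).hasDerivAt).add
          (((((hαsm.slice_right ht).differentiable (by simp) θ).hasDerivAt).log hα0.ne').div_const 2)
      have d' : pθ (betaF ν α) t θ = 2 * t * (pt U t θ * pθ U t θ
          + Real.exp (2 * U t θ) ^ 2 / (4 * t ^ 2) * pt A t θ * pθ A t θ)
          - √(α t θ) * ∫ v, f t θ v * v.1 := by
        rw [pθ, d.deriv, hnuth t ht θ, hexp, div_div, mul_comm (α t θ) 2]
        ring
      rw [d', add_zero]
      refine (abs_gradient_le (Real.sqrt_pos.2 hα0) (hpos t ht) (hj t ht θ) (hk t ht θ)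
        (abs_momentum_le hα0 (hfc' t ht θ) (hfnn t ht θ) (hfsupp' t ht θ)) (hN t ht θ)).trans ?_
      exact mul_le_mul_of_nonneg_right ht.2 (he0 t ht θ)
  obtain ⟨B₂, hB₂⟩ : ∃ B, ∀ t ∈ Ioc tp ti, ∫ θ in (0 : ℝ)..1, |pθ U t θ| ≤ B := by
    refine exists_bound_Ioc ⟨1 / 2 * B + 1 / √c / 2, fun t ht' => ?_⟩
    have ht := hsub ht'
    have h := integral_le_affine (contDiff_pθ (hU t ht)).continuous.abs (hec t ht') (p := 1 / 2)
      (q := 1 / √c / 2) fun θ => ?_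
    · have := hB t ht'
      rw [Etilde] at this
      linarith
    · have h1 : √(α t θ) * pθ U t θ ^ 2 ≤ e t θ :=
        (le_add_of_nonneg_right (by positivity)).trans (hfield t ht θ)
      have := two_mul_abs_le (Real.sqrt_pos.2 (hαpos t ht θ)) h1
      have := hD t ht θ
      linarith
  obtain ⟨B₃, hB₃⟩ : ∃ B, ∀ t ∈ Ioc tp ti,
      ∫ θ in (0 : ℝ)..1, Real.exp (2 * U t θ) * |pθ A t θ| ≤ B := by
    refine exists_bound_Ioc ⟨2 * ti ^ 2 * B + 1 / √c / 2, fun t ht' => ?_⟩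
    have ht := hsub ht'
    have ht0 := hpos t ht
    have h := integral_le_affine (g := fun θ => Real.exp (2 * U t θ) * |pθ A t θ|)
      ((Real.continuous_exp.comp ((hU t ht).continuous.const_mul 2)).mul
        (contDiff_pθ (hA t ht)).continuous.abs) (hec t ht') (p := 2 * ti ^ 2)
      (q := 1 / √c / 2) fun θ => ?_
    · have := mul_le_mul_of_nonneg_left (hB t ht') (by positivity : 0 ≤ 2 * ti ^ 2)
      rw [Etilde] at this
      linarith
    · have h1 : √(α t θ) * (Real.exp (2 * U t θ) * pθ A t θ) ^ 2 / (4 * t ^ 2) ≤ e t θ :=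
        (le_add_of_nonneg_left (by positivity)).trans (hfield t ht θ)
      rw [div_le_iff₀ (by positivity)] at h1
      have h2 := two_mul_abs_le (Real.sqrt_pos.2 (hαpos t ht θ)) h1
      rw [abs_mul, abs_of_pos (Real.exp_pos _)] at h2
      have h3 := hD t ht θ
      have h4 : e t θ * (4 * t ^ 2) ≤ e t θ * (4 * ti ^ 2) :=
        mul_le_mul_of_nonneg_left (by nlinarith [ht.2]) (he0 t ht θ)
      linarith
  have hcurrent : ∀ {w : ℝ × ℝ → ℝ} {F : ℝ → ℝ → ℝ}, Continuous w →
      (∀ t ∈ Ioc tp ti, ContDiff ℝ (⊤ : ℕ∞) (F t)) →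
      (∀ t ∈ Ioc tp ti, ∀ θ, pθ F t θ = 2 * ∫ v, f t θ v * w v.2) → ∀ t ∈ Ioc tp ti,
      ∫ θ in (0 : ℝ)..1, |pθ F t θ| ≤ 2 * ∫ θ in Icc (0 : ℝ) 1, ∫ v, f ti θ v * |w v.2| := by
    intro w F hw hF hFθ t ht
    refine (integral_abs_current_le (hfc t ht) (hfnn t ht) (hfsupp t ht) hw
      (contDiff_pθ (hF t ht)).continuous (hFθ t ht)).trans ?_
    refine mul_le_mul_of_nonneg_left ?_ two_pos.le
    exact weighted_particle_number_le htp hUsm hAsm hνsm hαsm hJsm hKsm hfsm hUper hAper hνper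
      hαper hfper hαpos hfnn hfsupp hvlasov hw.abs (fun _ => abs_nonneg _) ht
  obtain ⟨B₄, hB₄⟩ : ∃ B, ∀ t ∈ Ioc tp ti, ∫ θ in (0 : ℝ)..1, |pθ J t θ| ≤ B :=
    ⟨_, hcurrent (w := fun w => w.1) continuous_fst hJ hjth⟩
  obtain ⟨B₅, hB₅⟩ : ∃ B, ∀ t ∈ Ioc tp ti, ∫ θ in (0 : ℝ)..1, |pθ K t θ| ≤ B :=
    ⟨_, hcurrent (w := fun w => w.2) continuous_snd hK hkth⟩
  have n₁ := abs_nonneg B₁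
  have n₂ := abs_nonneg B₂
  have n₃ := abs_nonneg B₃
  have n₄ := abs_nonneg B₄
  have n₅ := abs_nonneg B₅
  refine ⟨1 + |B₁| + |B₂| + |B₃| + |B₄| + |B₅|, by positivity, fun t ht => ?_⟩
  have l₁ : (∫ θ in (0 : ℝ)..1, |pθ (betaF ν α) t θ|) < 1 + |B₁| + |B₂| + |B₃| + |B₄| + |B₅| := by
    linarith [hB₁ t ht, le_abs_self B₁]
  have l₂ : (∫ θ in (0 : ℝ)..1, |pθ U t θ|) < 1 + |B₁| + |B₂| + |B₃| + |B₄| + |B₅| := by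
    linarith [hB₂ t ht, le_abs_self B₂]
  have l₄ : (∫ θ in (0 : ℝ)..1, |pθ J t θ|) < 1 + |B₁| + |B₂| + |B₃| + |B₄| + |B₅| := by
    linarith [hB₄ t ht, le_abs_self B₄]
  have l₅ : (∫ θ in (0 : ℝ)..1, |pθ K t θ|) < 1 + |B₁| + |B₂| + |B₃| + |B₄| + |B₅| := by
    linarith [hB₅ t ht, le_abs_self B₅]
  refine ⟨l₁, l₂, by linarith [hB₃ t ht, le_abs_self B₃], l₄, l₅, fun x hx y hy => ⟨?_, ?_, ?_, ?_⟩⟩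
  · exact (sub_le_integral_abs_deriv (hβ t ht) hx hy).trans_lt l₁
  · exact (sub_le_integral_abs_deriv (hU t ht) hx hy).trans_lt l₂
  · exact (sub_le_integral_abs_deriv (hJ t ht) hx hy).trans_lt l₄
  · exact (sub_le_integral_abs_deriv (hK t ht) hx hy).trans_lt l₅
end
end
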